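/- arXiv:2605.06521 — 4 statements merged into one kernel-verified Lean document; each statement's English description precedes it below -/
import Mathlib

section
/- For every non-increasing reward function R: ℕ∪{∞} → ℝ₊ with R(∞) = 0, the supremum over all (history-dependent) policies A^∞ of 𝔼_{π₁^⊗}[R(τ^{A^∞})] equals the supremum over all Markov policies a^∞ of 𝔼_{π₁^⊗}[R(τ^{a^∞})]. -/
open MeasureTheory ProbabilityTheory ENNReal NNReal Set Filter

attribute [local instance] Classical.propDecidable

noncomputable section

variable {𝒳 𝒜 : Type*} [MeasurableSpace 𝒳] [MeasurableSpace 𝒜]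

/-- `P` is the law of an i.i.d. sequence of draws from `π`: the infinite product measure
`π^⊗` on the path space `𝒳^∞`, characterized through its finite-dimensional marginals. -/
def IsIIDProduct {𝒳 : Type*} [MeasurableSpace 𝒳] (π : Measure 𝒳)
    (P : Measure (ℕ → 𝒳)) : Prop :=
  IsProbabilityMeasure P ∧
    ∀ n : ℕ, P.map (fun x (i : Fin n) => x i.val) = Measure.pi (fun _ : Fin n => π)

/-- Wealth process of a (history-dependent) policy `A` in the testing-by-betting game with
action space `𝒜` and bets `φ`. -/
def polWealth (φ : 𝒜 → 𝒳 → ℝ≥0) (A : (n : ℕ) → (Fin n → 𝒳) → 𝒜) : ℕ → (ℕ → 𝒳) → ℝ≥0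
  | 0, _ => 1
  | n + 1, x => polWealth φ A n x * φ (A n (fun i => x i.val)) (x n)

/-- Rejection time of a policy: the first round `t ≥ 1` at which the wealth reaches `α⁻¹`
(`⊤ = ∞` if this never happens). -/
def polRejTime (φ : 𝒜 → 𝒳 → ℝ≥0) (α : ℝ≥0) (A : (n : ℕ) → (Fin n → 𝒳) → 𝒜)
    (x : ℕ → 𝒳) : ℕ∞ :=
  ⨅ (t : ℕ) (_ : 1 ≤ t ∧ α⁻¹ ≤ polWealth φ A t x), (t : ℕ∞)

/-- Wealth process of a Markov policy `a`, where `a n` is the action chosen at round `n+1`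
as a Borel function of the current wealth `w ∈ [0, α⁻¹)`.  Once the wealth leaves
`[0, α⁻¹)` (the rejection threshold has been reached) the process is frozen: the choice of
action is then irrelevant. -/
def mkvWealth (φ : 𝒜 → 𝒳 → ℝ≥0) (α : ℝ≥0)
    (a : (n : ℕ) → (Set.Ico (0 : ℝ≥0) α⁻¹) → 𝒜) : ℕ → (ℕ → 𝒳) → ℝ≥0
  | 0, _ => 1
  | n + 1, x =>
      if h : mkvWealth φ α a n x ∈ Set.Ico (0 : ℝ≥0) α⁻¹ then
        mkvWealth φ α a n x * φ (a n ⟨mkvWealth φ α a n x, h⟩) (x n)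
      else mkvWealth φ α a n x

/-- Rejection time of a Markov policy. -/
def mkvRejTime (φ : 𝒜 → 𝒳 → ℝ≥0) (α : ℝ≥0)
    (a : (n : ℕ) → (Set.Ico (0 : ℝ≥0) α⁻¹) → 𝒜) (x : ℕ → 𝒳) : ℕ∞ :=
  ⨅ (t : ℕ) (_ : 1 ≤ t ∧ α⁻¹ ≤ mkvWealth φ α a t x), (t : ℕ∞)

set_option linter.unusedSectionVars false

/-- One round of betting, frozen once the wealth has reached the threshold `c`. -/
def frozenStep (φ : 𝒜 → 𝒳 → ℝ≥0) (c w : ℝ≥0) (a : 𝒜) (x : 𝒳) : ℝ≥0 :=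
  if w < c then w * φ a x else w

/-- The wealth process of a history-dependent policy, frozen at the rejection time. -/
def frozenWealth (φ : 𝒜 → 𝒳 → ℝ≥0) (c : ℝ≥0) (A : (n : ℕ) → (Fin n → 𝒳) → 𝒜) :
    ℕ → (ℕ → 𝒳) → ℝ≥0
  | 0, _ => 1
  | n + 1, x => frozenStep φ c (frozenWealth φ c A n x) (A n (fun i => x i.val)) (x n)

/-- Extension of a finite history to an infinite path by an arbitrary constant. -/
def extendHistory [Nonempty 𝒳] (n : ℕ) (h : Fin n → 𝒳) (k : ℕ) : 𝒳 :=
  if hk : k < n then h ⟨k, hk⟩ else Classical.arbitrary 𝒳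

lemma measurable_extendHistory [Nonempty 𝒳] (n : ℕ) :
    Measurable (extendHistory n : (Fin n → 𝒳) → ℕ → 𝒳) := by
  refine measurable_pi_iff.2 fun k => ?_
  unfold extendHistory
  split_ifs <;> fun_prop

lemma extendHistory_apply [Nonempty 𝒳] {n k : ℕ} (hk : k < n) (x : ℕ → 𝒳) :
    extendHistory n (fun i => x i.val) k = x k := by
  simp [extendHistory, hk]

/-- Extension of a Markov decision rule to all wealth levels. -/
def extendRule [Nonempty 𝒜] {c : ℝ≥0} (a : Set.Ico (0 : ℝ≥0) c → 𝒜) (w : ℝ≥0) : 𝒜 :=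
  if h : w ∈ Set.Ico (0 : ℝ≥0) c then a ⟨w, h⟩ else Classical.arbitrary 𝒜

lemma measurable_extendRule [Nonempty 𝒜] {c : ℝ≥0} {a : Set.Ico (0 : ℝ≥0) c → 𝒜}
    (ha : Measurable a) : Measurable (extendRule a) :=
  Measurable.dite (f := a) (g := fun _ => Classical.arbitrary 𝒜) ha measurable_const
    measurableSet_Ico

lemma measurable_frozenStep {φ : 𝒜 → 𝒳 → ℝ≥0}
    (hφ : Measurable (fun p : 𝒜 × 𝒳 => φ p.1 p.2)) (c : ℝ≥0) :
    Measurable (fun p : (ℝ≥0 × 𝒜) × 𝒳 => frozenStep φ c p.1.1 p.1.2 p.2) := by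
  refine Measurable.ite (measurableSet_lt (by fun_prop) measurable_const) ?_ (by fun_prop)
  exact (measurable_fst.comp measurable_fst).mul
    (hφ.comp ((measurable_snd.comp measurable_fst).prodMk measurable_snd))

lemma mkvWealth_succ [Nonempty 𝒜] (φ : 𝒜 → 𝒳 → ℝ≥0) (α : ℝ≥0)
    (a : (n : ℕ) → Set.Ico (0 : ℝ≥0) α⁻¹ → 𝒜) (n : ℕ) (x : ℕ → 𝒳) :
    mkvWealth φ α a (n + 1) x = frozenStep φ α⁻¹ (mkvWealth φ α a n x)
      (extendRule (a n) (mkvWealth φ α a n x)) (x n) := by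
  rw [mkvWealth, frozenStep, extendRule]
  by_cases h : mkvWealth φ α a n x < α⁻¹ <;> simp [h]

lemma mkvWealth_succ_restrict (φ : 𝒜 → 𝒳 → ℝ≥0) (α : ℝ≥0) (f : ℕ → ℝ≥0 → 𝒜) (n : ℕ)
    (x : ℕ → 𝒳) :
    mkvWealth φ α (fun n w => f n w.val) (n + 1) x =
      frozenStep φ α⁻¹ (mkvWealth φ α (fun n w => f n w.val) n x)
        (f n (mkvWealth φ α (fun n w => f n w.val) n x)) (x n) := by
  rw [mkvWealth, frozenStep]
  by_cases h : mkvWealth φ α (fun n w => f n w.val) n x < α⁻¹ <;> simp [h]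

lemma mkvWealth_congr {φ : 𝒜 → 𝒳 → ℝ≥0} {α : ℝ≥0}
    {a a' : (n : ℕ) → Set.Ico (0 : ℝ≥0) α⁻¹ → 𝒜} {x x' : ℕ → 𝒳} {n : ℕ}
    (ha : ∀ k < n, a k = a' k) (hx : ∀ k < n, x k = x' k) :
    mkvWealth φ α a n x = mkvWealth φ α a' n x' := by
  induction n with
  | zero => rfl
  | succ n ih =>
    simp only [mkvWealth, ih (fun k hk => ha k (hk.trans n.lt_succ_self))
      (fun k hk => hx k (hk.trans n.lt_succ_self)), ha n n.lt_succ_self, hx n n.lt_succ_self]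

lemma frozenWealth_congr {φ : 𝒜 → 𝒳 → ℝ≥0} {c : ℝ≥0} {A : (n : ℕ) → (Fin n → 𝒳) → 𝒜}
    {x x' : ℕ → 𝒳} {n : ℕ} (hx : ∀ k < n, x k = x' k) :
    frozenWealth φ c A n x = frozenWealth φ c A n x' := by
  induction n with
  | zero => rfl
  | succ n ih =>
    have h : (fun i : Fin n => x i.val) = fun i : Fin n => x' i.val :=
      funext fun i => hx i (i.2.trans n.lt_succ_self)
    simp only [frozenWealth, ih (fun k hk => hx k (hk.trans n.lt_succ_self)), h,
      hx n n.lt_succ_self]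

lemma measurable_frozenWealth {φ : 𝒜 → 𝒳 → ℝ≥0}
    (hφ : Measurable (fun p : 𝒜 × 𝒳 => φ p.1 p.2)) (c : ℝ≥0)
    {A : (n : ℕ) → (Fin n → 𝒳) → 𝒜} (hA : ∀ n, Measurable (A n)) (n : ℕ) :
    Measurable (frozenWealth φ c A n) := by
  induction n with
  | zero => exact measurable_const
  | succ n ih =>
    exact (measurable_frozenStep hφ c).comp
      ((ih.prodMk ((hA n).comp (by fun_prop))).prodMk (measurable_pi_apply n))

lemma measurable_mkvWealth [Nonempty 𝒜] {φ : 𝒜 → 𝒳 → ℝ≥0}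
    (hφ : Measurable (fun p : 𝒜 × 𝒳 => φ p.1 p.2)) (α : ℝ≥0)
    {a : (n : ℕ) → Set.Ico (0 : ℝ≥0) α⁻¹ → 𝒜} (ha : ∀ n, Measurable (a n)) (n : ℕ) :
    Measurable (mkvWealth φ α a n) := by
  induction n with
  | zero => exact measurable_const
  | succ n ih =>
    rw [funext (mkvWealth_succ φ α a n)]
    exact (measurable_frozenStep hφ α⁻¹).comp
      ((ih.prodMk ((measurable_extendRule (ha n)).comp ih)).prodMk (measurable_pi_apply n))

/-- Joint measurability of the wealth of a Markov policy in the path and in a randomization. -/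
lemma measurable_mkvWealth_uncurry {U : Type*} [MeasurableSpace U] {φ : 𝒜 → 𝒳 → ℝ≥0}
    (hφ : Measurable (fun p : 𝒜 × 𝒳 => φ p.1 p.2)) (α : ℝ≥0)
    {F : ℕ → ℝ≥0 → U → 𝒜} (hF : ∀ n, Measurable (Function.uncurry (F n))) (n : ℕ) :
    Measurable (fun p : (ℕ → U) × (ℕ → 𝒳) =>
      mkvWealth φ α (fun k w => F k w.val (p.1 k)) n p.2) := by
  induction n with
  | zero => exact measurable_const
  | succ n ih =>
    simp_rw [fun p : (ℕ → U) × (ℕ → 𝒳) =>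
      mkvWealth_succ_restrict φ α (fun k w => F k w (p.1 k)) n p.2]
    exact (measurable_frozenStep hφ α⁻¹).comp
      ((ih.prodMk ((hF n).comp (ih.prodMk (by fun_prop)))).prodMk (by fun_prop))

lemma hittingTime_le_iff (p : ℕ → Prop) (n : ℕ) :
    (⨅ (t : ℕ) (_ : 1 ≤ t ∧ p t), (t : ℕ∞)) ≤ n ↔ ∃ t ≤ n, 1 ≤ t ∧ p t := by
  constructor
  · intro h
    by_contra! hne
    have h' : ((n + 1 : ℕ) : ℕ∞) ≤ ⨅ (t : ℕ) (_ : 1 ≤ t ∧ p t), (t : ℕ∞) := by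
      refine le_iInf₂ fun t ht => ?_
      have : n < t := by
        by_contra! hle
        exact hne t hle ht.1 ht.2
      exact_mod_cast this
    have := h'.trans h
    norm_cast at this
    omega
  · rintro ⟨t, htn, ht⟩
    exact (iInf₂_le t ht).trans (by exact_mod_cast htn)

lemma frozenWealth_eq_polWealth {φ : 𝒜 → 𝒳 → ℝ≥0} {c : ℝ≥0}
    {A : (n : ℕ) → (Fin n → 𝒳) → 𝒜} {x : ℕ → 𝒳} {n : ℕ}
    (h : ∀ k < n, polWealth φ A k x < c) : frozenWealth φ c A n x = polWealth φ A n x := by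
  induction n with
  | zero => rfl
  | succ n ih =>
    rw [frozenWealth, polWealth, ih fun k hk => h k (hk.trans n.lt_succ_self), frozenStep,
      if_pos (h n n.lt_succ_self)]

lemma monotone_of_frozen {c : ℝ≥0} {W : ℕ → ℝ≥0} (h : ∀ n, c ≤ W n → W (n + 1) = W n) :
    Monotone fun n => c ≤ W n :=
  monotone_nat_of_le_succ fun n hn => (h n hn).symm ▸ hn

lemma polRejTime_le_iff {φ : 𝒜 → 𝒳 → ℝ≥0} {α : ℝ≥0} (hα : 1 < α⁻¹)
    (A : (n : ℕ) → (Fin n → 𝒳) → 𝒜) (x : ℕ → 𝒳) (n : ℕ) :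
    polRejTime φ α A x ≤ n ↔ α⁻¹ ≤ frozenWealth φ α⁻¹ A n x := by
  have hmono : Monotone fun n => α⁻¹ ≤ frozenWealth φ α⁻¹ A n x :=
    monotone_of_frozen fun n hn => by simp [frozenWealth, frozenStep, hn.not_gt]
  rw [polRejTime, hittingTime_le_iff]
  constructor
  · rintro ⟨t, htn, -, ht⟩
    have hex : ∃ k, α⁻¹ ≤ polWealth φ A k x := ⟨t, ht⟩
    refine hmono ((Nat.find_min' hex ht).trans htn) ?_
    change α⁻¹ ≤ frozenWealth φ α⁻¹ A (Nat.find hex) x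
    rw [frozenWealth_eq_polWealth fun k hk => not_le.1 (Nat.find_min hex hk)]
    exact Nat.find_spec hex
  · intro h
    by_contra! hne
    have hlt : ∀ k ≤ n, polWealth φ A k x < α⁻¹ := fun k hk => by
      rcases Nat.eq_zero_or_pos k with rfl | hpos
      · exact hα
      · exact hne k hk hpos
    rw [frozenWealth_eq_polWealth fun k hk => hlt k hk.le] at h
    exact h.not_gt (hlt n le_rfl)

lemma mkvRejTime_le_iff {φ : 𝒜 → 𝒳 → ℝ≥0} {α : ℝ≥0} (hα : 1 < α⁻¹)
    (a : (n : ℕ) → Set.Ico (0 : ℝ≥0) α⁻¹ → 𝒜) (x : ℕ → 𝒳) (n : ℕ) :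
    mkvRejTime φ α a x ≤ n ↔ α⁻¹ ≤ mkvWealth φ α a n x := by
  have hmono : Monotone fun n => α⁻¹ ≤ mkvWealth φ α a n x :=
    monotone_of_frozen fun n hn => by simp [mkvWealth, hn.not_gt]
  rw [mkvRejTime, hittingTime_le_iff]
  refine ⟨fun ⟨t, htn, _, ht⟩ => hmono htn ht, fun h => ⟨n, le_rfl, ?_, h⟩⟩
  rcases Nat.eq_zero_or_pos n with rfl | hpos
  · exact absurd h hα.not_ge
  · exact hpos

instance ENat.borelSpace : BorelSpace ℕ∞ :=
  ⟨(top_unique fun s _ => by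
    let _ : MeasurableSpace ℕ∞ := borel ℕ∞
    have : BorelSpace ℕ∞ := ⟨rfl⟩
    exact s.to_countable.measurableSet : borel ℕ∞ = ⊤).symm⟩

/-- Hitting times described by the same one-dimensional wealth marginals give the same expected
reward. -/
lemma lintegral_reward_eq {Ω Ω' : Type*} [MeasurableSpace Ω] [MeasurableSpace Ω']
    {μ : Measure Ω} {μ' : Measure Ω'} [IsProbabilityMeasure μ] [IsProbabilityMeasure μ']
    {c : ℝ≥0} {W : ℕ → Ω → ℝ≥0} {W' : ℕ → Ω' → ℝ≥0} (hW : ∀ n, Measurable (W n))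
    (hW' : ∀ n, Measurable (W' n)) {τ : Ω → ℕ∞} {τ' : Ω' → ℕ∞}
    (hτ : ∀ ω (n : ℕ), τ ω ≤ n ↔ c ≤ W n ω) (hτ' : ∀ ω (n : ℕ), τ' ω ≤ n ↔ c ≤ W' n ω)
    (hlaw : ∀ n, μ.map (W n) = μ'.map (W' n)) (R : ℕ∞ → ℝ≥0∞) :
    Measurable τ' ∧ ∫⁻ ω, R (τ ω) ∂μ = ∫⁻ ω, R (τ' ω) ∂μ' := by
  have hset : ∀ n : ℕ, τ ⁻¹' Set.Iic (n : ℕ∞) = W n ⁻¹' Set.Ici c := fun n =>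
    Set.ext fun ω => hτ ω n
  have hset' : ∀ n : ℕ, τ' ⁻¹' Set.Iic (n : ℕ∞) = W' n ⁻¹' Set.Ici c := fun n =>
    Set.ext fun ω => hτ' ω n
  have hm : Measurable τ := by
    refine measurable_of_Iic fun n => ?_
    induction n using ENat.recTopCoe with
    | top => simp
    | coe n => exact hset n ▸ hW n measurableSet_Ici
  have hm' : Measurable τ' := by
    refine measurable_of_Iic fun n => ?_
    induction n using ENat.recTopCoe with
    | top => simp
    | coe n => exact hset' n ▸ hW' n measurableSet_Ici
  have := Measure.isProbabilityMeasure_map (μ := μ) hm.aemeasurable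
  have := Measure.isProbabilityMeasure_map (μ := μ') hm'.aemeasurable
  have heq : μ.map τ = μ'.map τ' := by
    refine Measure.ext_of_Iic _ _ fun n => ?_
    induction n using ENat.recTopCoe with
    | top => simp
    | coe n =>
      rw [Measure.map_apply hm measurableSet_Iic, Measure.map_apply hm' measurableSet_Iic,
        hset, hset', ← Measure.map_apply (hW n) measurableSet_Ici, hlaw n,
        Measure.map_apply (hW' n) measurableSet_Ici]
  refine ⟨hm', ?_⟩
  rw [← lintegral_map (measurable_of_countable R) hm, heq,
    lintegral_map (measurable_of_countable R) hm']

lemma isIIDProduct_infinitePi (π : Measure 𝒳) [IsProbabilityMeasure π] :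
    IsIIDProduct π (Measure.infinitePi fun _ : ℕ => π) := by
  refine ⟨inferInstance, fun n => (Measure.pi_eq fun s hs => ?_).symm⟩
  rw [Measure.map_apply (by fun_prop) (.univ_pi hs)]
  let t : ℕ → Set 𝒳 := fun k => if hk : k < n then s ⟨k, hk⟩ else Set.univ
  have hpre : (fun (x : ℕ → 𝒳) (i : Fin n) => x i.val) ⁻¹' Set.univ.pi s =
      Set.pi (Finset.range n) t := by
    ext x
    simp only [Set.mem_preimage, Set.mem_pi, Set.mem_univ, true_imp_iff, Finset.coe_range,
      Set.mem_Iio]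
    exact ⟨fun h k hk => by simpa [t, hk] using h ⟨k, hk⟩,
      fun h i => by simpa [t] using h i i.2⟩
  rw [hpre, Measure.infinitePi_pi _ fun k hk => by
    simpa [t, Finset.mem_range.1 hk] using hs ⟨k, Finset.mem_range.1 hk⟩,
    Finset.prod_range]
  simp [t]

/-- Under an i.i.d. law, the history before round `n` is independent of the draw at round `n`. -/
lemma IsIIDProduct.measurePreserving_split {π : Measure 𝒳} [IsProbabilityMeasure π]
    {P : Measure (ℕ → 𝒳)} (hP : IsIIDProduct π P) (n : ℕ) :
    MeasurePreserving (fun x : ℕ → 𝒳 => ((fun i : Fin n => x i.val), x n)) P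
      ((Measure.pi fun _ : Fin n => π).prod π) := by
  have h₁ : MeasurePreserving (fun (x : ℕ → 𝒳) (i : Fin (n + 1)) => x i.val) P
      (Measure.pi fun _ => π) := ⟨by fun_prop, hP.2 (n + 1)⟩
  have h := Measure.measurePreserving_swap.comp
    ((measurePreserving_piFinSuccAbove (fun _ : Fin (n + 1) => π) (Fin.last n)).comp h₁)
  convert h using 1
  funext x
  simp [MeasurableEquiv.piFinSuccAbove, Fin.insertNthEquiv]
  rfl

lemma measurePreserving_prodProdProdComm {α β γ δ : Type*} [MeasurableSpace α]
    [MeasurableSpace β] [MeasurableSpace γ] [MeasurableSpace δ] (a : Measure α) (b : Measure β)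
    (c : Measure γ) (d : Measure δ) [SFinite a] [SFinite b] [SFinite c] [SFinite d] :
    MeasurePreserving (fun p : (α × β) × (γ × δ) => ((p.1.1, p.2.1), (p.1.2, p.2.2)))
      ((a.prod b).prod (c.prod d)) ((a.prod c).prod (b.prod d)) := by
  refine ⟨by fun_prop, Measure.ext_of_lintegral _ fun f hf => ?_⟩
  rw [lintegral_map hf (by fun_prop), lintegral_prod _ (by fun_prop),
    lintegral_prod _ (by fun_prop), lintegral_prod _ (by fun_prop),
    lintegral_prod _ (by fun_prop)]
  refine lintegral_congr fun x => ?_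
  have h₁ : ∀ y, ∫⁻ q : γ × δ, f ((x, q.1), (y, q.2)) ∂c.prod d =
      ∫⁻ z, ∫⁻ w, f ((x, z), (y, w)) ∂d ∂c := fun y => lintegral_prod _ (by fun_prop)
  have h₂ : ∀ z, ∫⁻ q : β × δ, f ((x, z), q) ∂b.prod d =
      ∫⁻ y, ∫⁻ w, f ((x, z), (y, w)) ∂d ∂b := fun z => lintegral_prod _ (by fun_prop)
  simp_rw [h₁, h₂]
  exact lintegral_lintegral_swap (by fun_prop)

lemma MeasureTheory.MeasurePreserving.map_past_prod {Ω α β γ : Type*} [MeasurableSpace Ω] [MeasurableSpace α]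
    [MeasurableSpace β] [MeasurableSpace γ] {μ : Measure Ω} {ρ : Measure α} {ζ : Measure β}
    [SFinite ρ] [IsProbabilityMeasure ζ] {r : Ω → α} {z : Ω → β}
    (h : MeasurePreserving (fun ω => (r ω, z ω)) μ (ρ.prod ζ)) {g : α → γ} (hg : Measurable g) :
    μ.map (fun ω => (g (r ω), z ω)) = (μ.map fun ω => g (r ω)).prod ζ := by
  have h₁ : μ.map (fun ω => g (r ω)) = ρ.map g := by
    have : (fun ω => g (r ω)) = (g ∘ Prod.fst) ∘ fun ω => (r ω, z ω) := rfl
    rw [this, ← Measure.map_map (by fun_prop) h.measurable, h.map_eq,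
      ← Measure.map_map hg measurable_fst, ← Measure.fst, Measure.fst_prod]
  have h₂ : (fun ω => (g (r ω), z ω)) = Prod.map g id ∘ fun ω => (r ω, z ω) := rfl
  rw [h₁, h₂, ← Measure.map_map (by fun_prop) h.measurable, h.map_eq,
    ← Measure.map_prod_map _ _ hg measurable_id, Measure.map_id]

/-- Every history-dependent policy is matched in wealth marginals by a randomized Markov policy. -/
lemma exists_randomized_markov [StandardBorelSpace 𝒜] [Nonempty 𝒜] [Nonempty 𝒳]
    {φ : 𝒜 → 𝒳 → ℝ≥0} (hφ : Measurable (fun p : 𝒜 × 𝒳 => φ p.1 p.2)) (α : ℝ≥0)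
    {π : Measure 𝒳} [IsProbabilityMeasure π] {P : Measure (ℕ → 𝒳)} (hP : IsIIDProduct π P)
    {A : (n : ℕ) → (Fin n → 𝒳) → 𝒜} (hA : ∀ n, Measurable (A n)) :
    ∃ F : ℕ → ℝ≥0 → unitInterval → 𝒜, (∀ n, Measurable (Function.uncurry (F n))) ∧
      ∀ n, P.map (frozenWealth φ α⁻¹ A n) =
        ((Measure.infinitePi fun _ : ℕ => (volume : Measure unitInterval)).prod P).map
          (fun p => mkvWealth φ α (fun k w => F k w.val (p.1 k)) n p.2) := by
  have := hP.1
  let B : (n : ℕ) → (ℕ → 𝒳) → 𝒜 := fun n x => A n fun i => x i.val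
  have hB : ∀ n, Measurable (B n) := fun n => (hA n).comp (by fun_prop)
  choose F hF hFκ using fun n => Kernel.exists_measurable_map_eq_unitInterval
    (condDistrib (B n) (frozenWealth φ α⁻¹ A n) P)
  refine ⟨F, hF, fun n => ?_⟩
  set N := Measure.infinitePi fun _ : ℕ => (volume : Measure unitInterval) with hN
  have hNiid : IsIIDProduct volume N := isIIDProduct_infinitePi _
  let V : ℕ → (ℕ → unitInterval) × (ℕ → 𝒳) → ℝ≥0 := fun n p =>
    mkvWealth φ α (fun k w => F k w.val (p.1 k)) n p.2
  have hV : ∀ n, Measurable (V n) := measurable_mkvWealth_uncurry hφ α hF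
  have hW : ∀ n, Measurable (frozenWealth φ α⁻¹ A n) := measurable_frozenWealth hφ _ hA
  have hstep := measurable_frozenStep hφ α⁻¹
  change _ = (N.prod P).map (V n)
  induction n with
  | zero =>
    change P.map (fun _ => (1 : ℝ≥0)) = (N.prod P).map (fun _ => (1 : ℝ≥0))
    simp
  | succ n ih =>
    have hpol : P.map (fun x => ((frozenWealth φ α⁻¹ A n x, B n x), x n)) =
        ((P.map (frozenWealth φ α⁻¹ A n)) ⊗ₘ
          condDistrib (B n) (frozenWealth φ α⁻¹ A n) P).prod π := by
      have h := (hP.measurePreserving_split n).map_past_prod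
        (g := fun h => (frozenWealth φ α⁻¹ A n (extendHistory n h), A n h))
        (((hW n).comp (measurable_extendHistory n)).prodMk (hA n))
      have hext : ∀ x : ℕ → 𝒳, frozenWealth φ α⁻¹ A n (extendHistory n fun i => x i.val) =
          frozenWealth φ α⁻¹ A n x := fun x =>
        frozenWealth_congr fun k hk => extendHistory_apply hk x
      simp only [hext] at h
      rw [compProd_map_condDistrib (hB n).aemeasurable]
      exact h
    have hmkv : (N.prod P).map (fun p => (V n p, (p.1 n, p.2 n))) =
        ((N.prod P).map (V n)).prod ((volume : Measure unitInterval).prod π) := by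
      have h := ((measurePreserving_prodProdProdComm _ _ _ _).comp
        ((hNiid.measurePreserving_split n).prod
          (hP.measurePreserving_split n))).map_past_prod
        (r := fun p : (ℕ → unitInterval) × (ℕ → 𝒳) =>
          (fun i : Fin n => p.1 i.val, fun i : Fin n => p.2 i.val))
        (z := fun p : (ℕ → unitInterval) × (ℕ → 𝒳) => (p.1 n, p.2 n))
        (g := fun h => V n (extendHistory n h.1, extendHistory n h.2))
        ((hV n).comp (((measurable_extendHistory n).comp measurable_fst).prodMk
          ((measurable_extendHistory n).comp measurable_snd)))
      have hext : ∀ p : (ℕ → unitInterval) × (ℕ → 𝒳),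
          V n (extendHistory n fun i => p.1 i.val, extendHistory n fun i => p.2 i.val) =
            V n p := fun p =>
        mkvWealth_congr (fun k hk => by simp only [extendHistory_apply hk])
          (fun k hk => extendHistory_apply hk p.2)
      simp only [hext] at h
      exact h
    have hFn : Measurable fun q : ℝ≥0 × unitInterval × 𝒳 => F n q.1 q.2.1 :=
      (hF n).comp (measurable_fst.prodMk measurable_snd.fst)
    have hkernel : (((N.prod P).map (V n)).prod ((volume : Measure unitInterval).prod π)).map
        (fun q => ((q.1, F n q.1 q.2.1), q.2.2)) =
        (((N.prod P).map (V n)) ⊗ₘ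
          condDistrib (B n) (frozenWealth φ α⁻¹ A n) P).prod π := by
      have := Measure.isProbabilityMeasure_map (μ := N.prod P) (hV n).aemeasurable
      refine Measure.ext_of_lintegral _ fun f hf => ?_
      rw [lintegral_map hf (by fun_prop), lintegral_prod _ (by fun_prop),
        lintegral_prod _ (by fun_prop), Measure.lintegral_compProd (by fun_prop)]
      refine lintegral_congr fun w => ?_
      have hFw : Measurable (F n w) := (hF n).comp measurable_prodMk_left
      rw [lintegral_prod _ (by fun_prop), ← hFκ n w, lintegral_map (by fun_prop) hFw]
    have hsucc : V (n + 1) = (fun q : (ℝ≥0 × 𝒜) × 𝒳 => frozenStep φ α⁻¹ q.1.1 q.1.2 q.2) ∘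
        (fun q : ℝ≥0 × unitInterval × 𝒳 => ((q.1, F n q.1 q.2.1), q.2.2)) ∘
          fun p => (V n p, (p.1 n, p.2 n)) :=
      funext fun p => mkvWealth_succ_restrict φ α (fun k w => F k w (p.1 k)) n p.2
    have hVn := hV n
    rw [hsucc, ← Measure.map_map hstep (by fun_prop), ← Measure.map_map (by fun_prop)
      (by fun_prop), hmkv, hkernel, ← ih, ← hpol, Measure.map_map hstep
      (((hW n).prodMk (hB n)).prodMk (by fun_prop))]
    rfl

/-- Every Markov policy is realized by a history-dependent policy. -/
lemma exists_policy_of_markov [Nonempty 𝒜] [Nonempty 𝒳] {φ : 𝒜 → 𝒳 → ℝ≥0}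
    (hφ : Measurable (fun p : 𝒜 × 𝒳 => φ p.1 p.2)) {α : ℝ≥0} (hα : 1 < α⁻¹)
    {a : (n : ℕ) → Set.Ico (0 : ℝ≥0) α⁻¹ → 𝒜} (ha : ∀ n, Measurable (a n)) :
    ∃ A : (n : ℕ) → (Fin n → 𝒳) → 𝒜, (∀ n, Measurable (A n)) ∧
      ∀ x, polRejTime φ α A x = mkvRejTime φ α a x := by
  let A : (n : ℕ) → (Fin n → 𝒳) → 𝒜 := fun n h =>
    extendRule (a n) (mkvWealth φ α a n (extendHistory n h))
  refine ⟨A, fun n => (measurable_extendRule (ha n)).comp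
    ((measurable_mkvWealth hφ α ha n).comp (measurable_extendHistory n)), fun x => ?_⟩
  have hwealth : ∀ n, frozenWealth φ α⁻¹ A n x = mkvWealth φ α a n x := by
    intro n
    induction n with
    | zero => rfl
    | succ n ih =>
      have hext : mkvWealth φ α a n (extendHistory n fun i => x i.val) = mkvWealth φ α a n x :=
        mkvWealth_congr (fun _ _ => rfl) fun k hk => extendHistory_apply hk x
      rw [frozenWealth, mkvWealth_succ, ih, ← hext]
  refine eq_of_forall_ge_iff fun t => ?_
  induction t using ENat.recTopCoe with
  | top => simp
  | coe n => rw [polRejTime_le_iff hα, mkvRejTime_le_iff hα, hwealth]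

theorem markovian_reduction
    (𝒳 𝒜 : Type*) [MeasurableSpace 𝒳] [StandardBorelSpace 𝒳]
    [MeasurableSpace 𝒜] [StandardBorelSpace 𝒜]
    (𝒫₀ : Set (Measure 𝒳)) (h𝒫₀ : ∀ π ∈ 𝒫₀, IsProbabilityMeasure π)
    (φ : 𝒜 → 𝒳 → ℝ≥0) (hφ : Measurable (fun p : 𝒜 × 𝒳 => φ p.1 p.2))
    (hval : ∀ a : 𝒜, ∀ π ∈ 𝒫₀, ∫⁻ x, (φ a x : ℝ≥0∞) ∂π ≤ 1)
    (α : ℝ≥0) (hα : 0 < α) (hα1 : α < 1)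
    (π₁ : Measure 𝒳) [IsProbabilityMeasure π₁]
    (R : ℕ∞ → ℝ≥0) (hR : Antitone R) (hRtop : R ⊤ = 0)
    (P : Measure (ℕ → 𝒳)) (hP : IsIIDProduct π₁ P) :
    (⨆ (A : (n : ℕ) → (Fin n → 𝒳) → 𝒜) (_ : ∀ n, Measurable (A n)),
        ∫⁻ x, (R (polRejTime φ α A x) : ℝ≥0∞) ∂P)
      = ⨆ (a : (n : ℕ) → (Set.Ico (0 : ℝ≥0) α⁻¹) → 𝒜) (_ : ∀ n, Measurable (a n)),
          ∫⁻ x, (R (mkvRejTime φ α a x) : ℝ≥0∞) ∂P := by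
  have hc : 1 < α⁻¹ := (one_lt_inv₀ hα).2 hα1
  have := hP.1
  have : Nonempty 𝒳 := π₁.nonempty_of_neZero
  apply le_antisymm
  · refine iSup₂_le fun A hA => ?_
    have : Nonempty 𝒜 := ⟨A 0 finZeroElim⟩
    obtain ⟨F, hF, hlaw⟩ := exists_randomized_markov hφ α hP hA
    obtain ⟨hmeas, heq⟩ := lintegral_reward_eq (measurable_frozenWealth hφ α⁻¹ hA)
      (measurable_mkvWealth_uncurry hφ α hF) (polRejTime_le_iff hc A)
      (fun p => mkvRejTime_le_iff hc (fun k w => F k w.val (p.1 k)) p.2) hlaw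
      fun n => (R n : ℝ≥0∞)
    have hfin : ∫⁻ x, (R (polRejTime φ α A x) : ℝ≥0∞) ∂P ≠ ∞ := by
      refine ne_top_of_le_ne_top (coe_ne_top (r := R 0)) ?_
      calc ∫⁻ x, (R (polRejTime φ α A x) : ℝ≥0∞) ∂P ≤ ∫⁻ _, (R 0 : ℝ≥0∞) ∂P :=
            lintegral_mono fun x => coe_le_coe.2 (hR zero_le)
        _ = R 0 := by simp
    have hmeasR : Measurable fun n => (R n : ℝ≥0∞) := measurable_of_countable _
    have hprod := lintegral_prod (μ := Measure.infinitePi fun _ : ℕ => volume) (ν := P) _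
      (hmeasR.comp hmeas).aemeasurable
    replace heq := heq.trans hprod
    obtain ⟨u, hu⟩ := exists_lintegral_le (heq ▸ hfin)
    rw [heq]
    exact hu.trans (le_iSup₂_of_le (fun k w => F k w.val (u k))
      (fun k => (hF k).comp (measurable_subtype_coe.prodMk measurable_const)) le_rfl)
  · refine iSup₂_le fun a ha => ?_
    have : Nonempty 𝒜 := ⟨a 0 ⟨0, le_rfl, zero_lt_one.trans hc⟩⟩
    obtain ⟨A, hA, hτ⟩ := exists_policy_of_markov (𝒳 := 𝒳) hφ hc ha
    exact le_iSup₂_of_le A hA (by simp only [hτ, le_rfl])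

end
end

section
/- Fix a probability measure π₀ on a standard Borel space 𝒳 and let 𝒫^{π₀} = {ν ∈ 𝒫(𝒳) : ν ≪ π₀}. Then 𝒫^{π₀} is a standard Borel space (a Borel subset of 𝒫(𝒳)), and there exists a jointly Borel map φ^{π₀}: 𝒫^{π₀}×𝒳 → ℝ₊ such that for every ν ∈ 𝒫^{π₀} and every Borel set B ⊆ 𝒳, ν(B) = ∫_B φ^{π₀}(ν,x) dπ₀(x); that is, x ↦ φ^{π₀}(ν,x) is a version of the Radon–Nikodym derivative dν/dπ₀ for every ν. -/
open MeasureTheory ProbabilityTheory ENNReal NNReal Set Filter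

attribute [local instance] Classical.propDecidable

noncomputable section

/-- A measurable space with a measurable injection into a countably separated space is countably
separated. -/
theorem countablySeparated_of_measurable_injective {α β : Type*} [MeasurableSpace α]
    [MeasurableSpace β] [MeasurableSpace.CountablySeparated β] {f : α → β} (hf : Measurable f)
    (hinj : Function.Injective f) : MeasurableSpace.CountablySeparated α := by
  obtain ⟨S, hSc, hSm, hS⟩ := exists_countable_separating β MeasurableSet univ
  refine ⟨⟨(fun s => f ⁻¹' s) '' S, hSc.image _, ?_, ?_⟩⟩
  · rintro _ ⟨s, hs, rfl⟩
    exact hf (hSm s hs)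
  · intro x _ y _ h
    exact hinj (hS _ (mem_univ _) _ (mem_univ _) fun s hs => h _ (mem_image_of_mem _ hs))

/-- A countably separated space that is the image of a standard Borel space under a measurable
bijection is standard Borel. -/
theorem standardBorelSpace_of_measurable_bijective {α β : Type*} [MeasurableSpace α]
    [StandardBorelSpace α] [MeasurableSpace β] [MeasurableSpace.CountablySeparated β] {f : α → β}
    (hf : Measurable f) (hbij : Function.Bijective f) : StandardBorelSpace β := by
  let := upgradeStandardBorel α
  have hemb : MeasurableEmbedding f := hf.measurableEmbedding hbij.1
  let e : β ≃ α := (Equiv.ofBijective f hbij).symm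
  let : TopologicalSpace β := TopologicalSpace.induced e inferInstance
  have hind : Topology.IsInducing e := ⟨rfl⟩
  refine ⟨inferInstance, ⟨?_⟩, (e.toHomeomorphOfIsInducing hind).isClosedEmbedding.polishSpace⟩
  have hmeas : ∀ s : Set β, MeasurableSet s ↔ MeasurableSet (f ⁻¹' s) := fun s =>
    ⟨fun hs => hf hs, fun hs => by
      simpa [image_preimage_eq s hbij.2] using hemb.measurableSet_image.2 hs⟩
  rw [borel_comap, ← BorelSpace.measurable_eq (α := α)]
  ext s
  rw [hmeas, MeasurableSpace.measurableSet_comap]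
  constructor
  · refine fun hs => ⟨_, hs, ?_⟩
    ext b
    exact iff_of_eq (congrArg (· ∈ s) ((Equiv.ofBijective f hbij).apply_symm_apply b))
  · rintro ⟨t, ht, rfl⟩
    have hpre : f ⁻¹' (e ⁻¹' t) = t := by
      ext a
      exact iff_of_eq (congrArg (· ∈ t) ((Equiv.ofBijective f hbij).symm_apply_apply a))
    rwa [hpre]

/-- Probability measures on a countably generated space are countably separated. -/
theorem countablySeparated_subtype_isProbabilityMeasure {α : Type*} [MeasurableSpace α]
    [MeasurableSpace.CountablyGenerated α] {p : Measure α → Prop}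
    (hp : ∀ ν, p ν → IsProbabilityMeasure ν) :
    MeasurableSpace.CountablySeparated {ν : Measure α // p ν} := by
  let 𝒜 := generateSetAlgebra (MeasurableSpace.countableGeneratingSet α)
  have h𝒜c : 𝒜.Countable :=
    countable_generateSetAlgebra MeasurableSpace.countable_countableGeneratingSet
  have h𝒜gen : ‹MeasurableSpace α› = MeasurableSpace.generateFrom 𝒜 := by
    rw [generateFrom_generateSetAlgebra_eq, MeasurableSpace.generateFrom_countableGeneratingSet]
  have : Countable 𝒜 := h𝒜c
  refine countablySeparated_of_measurable_injective (β := 𝒜 → ℝ≥0∞)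
    (f := fun ν A => ν.1 A.1) ?_ ?_
  · refine measurable_pi_lambda _ fun A =>
      (Measure.measurable_coe ?_).comp measurable_subtype_coe
    rw [h𝒜gen]
    exact MeasurableSpace.measurableSet_generateFrom A.2
  · intro ν μ h
    have := hp _ ν.2
    have := hp _ μ.2
    refine Subtype.ext (ext_of_generate_finite 𝒜 h𝒜gen
      isSetAlgebra_generateSetAlgebra.isSetRing.isSetSemiring.isPiSystem
      (fun s hs => congrFun h ⟨s, hs⟩) (by simp))

/-- The probability measures absolutely continuous with respect to a finite measure on a countably
generated space form a standard Borel space. -/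
theorem standardBorelSpace_subtype_absolutelyContinuous {α : Type*} [MeasurableSpace α]
    [MeasurableSpace.CountablyGenerated α] (π : Measure α) [IsFiniteMeasure π] :
    StandardBorelSpace {ν : Measure α // IsProbabilityMeasure ν ∧ ν ≪ π} := by
  have := countablySeparated_subtype_isProbabilityMeasure
    (p := fun ν : Measure α => IsProbabilityMeasure ν ∧ ν ≪ π) fun _ h => h.1
  have : Fact ((1 : ℝ≥0∞) ≠ ∞) := ⟨one_ne_top⟩
  let : MeasurableSpace (Lp ℝ 1 π) := borel _
  have : BorelSpace (Lp ℝ 1 π) := ⟨rfl⟩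
  let S : Set (Lp ℝ 1 π) := {f | 0 ≤ f ∧ ∫ x, f x ∂π = 1}
  have hS : IsClosed S :=
    isClosed_nonneg.inter (isClosed_singleton.preimage continuous_integral)
  have : StandardBorelSpace S := hS.measurableSet.standardBorel
  have happly : ∀ f ∈ S, ∀ A, MeasurableSet A →
      π.withDensity (fun x => ENNReal.ofReal (f x)) A = ENNReal.ofReal (∫ x in A, f x ∂π) := by
    intro f hf A hA
    rw [withDensity_apply _ hA, ofReal_integral_eq_lintegral_ofReal
      (L1.integrable_coeFn f).integrableOn (ae_restrict_of_ae ((Lp.coeFn_nonneg f).2 hf.1))]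
  let Γ : S → {ν : Measure α // IsProbabilityMeasure ν ∧ ν ≪ π} := fun f =>
    ⟨π.withDensity (fun x => ENNReal.ofReal (f.1 x)),
      ⟨by rw [happly f.1 f.2 _ .univ, setIntegral_univ, f.2.2, ENNReal.ofReal_one]⟩,
      withDensity_absolutelyContinuous _ _⟩
  have hmeas : ∀ f : Lp ℝ 1 π, AEMeasurable (fun x => ENNReal.ofReal (f x)) π := fun f =>
    (Lp.aestronglyMeasurable f).aemeasurable.ennreal_ofReal
  refine standardBorelSpace_of_measurable_bijective (f := Γ) ?_ ⟨?_, ?_⟩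
  · refine Measurable.subtype_mk (Measure.measurable_of_measurable_coe _ fun A hA => ?_)
    simp_rw [fun f : S => happly f.1 f.2 A hA]
    exact ((continuous_setIntegral A).measurable.comp measurable_subtype_coe).ennreal_ofReal
  · intro f g h
    have h' : π.withDensity (fun x => ENNReal.ofReal (f.1 x)) =
        π.withDensity (fun x => ENNReal.ofReal (g.1 x)) := congrArg Subtype.val h
    have hfin : ∫⁻ x, ENNReal.ofReal (f.1 x) ∂π ≠ ∞ := by
      rw [← ofReal_integral_eq_lintegral_ofReal (L1.integrable_coeFn f.1)
        ((Lp.coeFn_nonneg f.1).2 f.2.1)]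
      exact ofReal_ne_top
    rw [withDensity_eq_iff (hmeas _) (hmeas _) hfin] at h'
    refine Subtype.ext (Lp.ext ?_)
    filter_upwards [h', (Lp.coeFn_nonneg f.1).2 f.2.1, (Lp.coeFn_nonneg g.1).2 g.2.1]
      with x hx hf hg
    exact (ENNReal.ofReal_eq_ofReal_iff hf hg).1 hx
  · rintro ⟨ν, hν, hac⟩
    have hint : Integrable (fun x => (ν.rnDeriv π x).toReal) π := Measure.integrable_toReal_rnDeriv
    refine ⟨⟨hint.toL1 _, ?_, ?_⟩, Subtype.ext ?_⟩
    · rw [← Lp.coeFn_nonneg]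
      filter_upwards [hint.coeFn_toL1] with x hx
      rw [hx]
      exact toReal_nonneg
    · rw [integral_congr_ae hint.coeFn_toL1, Measure.integral_toReal_rnDeriv hac]
      simp
    · refine (withDensity_congr_ae ?_).trans (Measure.withDensity_rnDeriv_eq ν π hac)
      filter_upwards [hint.coeFn_toL1, ν.rnDeriv_lt_top π] with x hx hlt
      rw [hx, ENNReal.ofReal_toReal hlt.ne]

/-- The probability measures absolutely continuous with respect to a finite measure on a countably
generated space form a measurable set of measures. -/
theorem measurableSet_isProbabilityMeasure_absolutelyContinuous {α : Type*} [MeasurableSpace α]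
    [MeasurableSpace.CountablyGenerated α] (π : Measure α) [IsFiniteMeasure π] :
    MeasurableSet {ν : Measure α | IsProbabilityMeasure ν ∧ ν ≪ π} := by
  have hprob : MeasurableSet {ν : Measure α | IsProbabilityMeasure ν} := by
    simp_rw [isProbabilityMeasure_iff]
    exact Measure.measurable_coe .univ (measurableSet_singleton 1)
  let κ : Kernel {ν : Measure α | IsProbabilityMeasure ν} α := ⟨Subtype.val, measurable_subtype_coe⟩
  have : IsMarkovKernel κ := ⟨fun ν => ν.2⟩
  have h := hprob.subtype_image (Kernel.measurableSet_absolutelyContinuous κ (Kernel.const _ π))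
  convert h using 1
  ext ν
  exact ⟨fun hν => ⟨⟨ν, hν.1⟩, hν.2, rfl⟩, by rintro ⟨μ, hμ, rfl⟩; exact ⟨μ.2, hμ⟩⟩

theorem canonical_action_space
    (𝒳 : Type*) [MeasurableSpace 𝒳] [StandardBorelSpace 𝒳]
    (π₀ : Measure 𝒳) [IsProbabilityMeasure π₀] :
    MeasurableSet {ν : Measure 𝒳 | IsProbabilityMeasure ν ∧ ν ≪ π₀} ∧
    StandardBorelSpace {ν : Measure 𝒳 // IsProbabilityMeasure ν ∧ ν ≪ π₀} ∧
    ∃ φ : {ν : Measure 𝒳 // IsProbabilityMeasure ν ∧ ν ≪ π₀} → 𝒳 → ℝ≥0,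
      Measurable (fun p : {ν : Measure 𝒳 // IsProbabilityMeasure ν ∧ ν ≪ π₀} × 𝒳 =>
        φ p.1 p.2) ∧
      ∀ (ν : {ν : Measure 𝒳 // IsProbabilityMeasure ν ∧ ν ≪ π₀}) (B : Set 𝒳),
        MeasurableSet B → ν.1 B = ∫⁻ x in B, (φ ν x : ℝ≥0∞) ∂π₀ := by
  refine ⟨measurableSet_isProbabilityMeasure_absolutelyContinuous π₀,
    standardBorelSpace_subtype_absolutelyContinuous π₀, ?_⟩
  let κ : Kernel {ν : Measure 𝒳 // IsProbabilityMeasure ν ∧ ν ≪ π₀} 𝒳 :=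
    ⟨Subtype.val, measurable_subtype_coe⟩
  let η : Kernel {ν : Measure 𝒳 // IsProbabilityMeasure ν ∧ ν ≪ π₀} 𝒳 := Kernel.const _ π₀
  have : IsMarkovKernel κ := ⟨fun ν => ν.2.1⟩
  refine ⟨fun ν x => (κ.rnDeriv η ν x).toNNReal, (κ.measurable_rnDeriv η).ennreal_toNNReal,
    fun ν B hB => ?_⟩
  have h : ∫⁻ x in B, κ.rnDeriv η ν x ∂π₀ = ν.1 B :=
    Kernel.setLIntegral_rnDeriv (κ := κ) (η := η) ν.2.2 hB
  rw [← h]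
  refine lintegral_congr_ae (ae_restrict_of_ae ?_)
  have hne : ∀ᵐ x ∂π₀, κ.rnDeriv η ν x ≠ ∞ := Kernel.rnDeriv_ne_top κ η
  filter_upwards [hne] with x hx
  exact (ENNReal.coe_toNNReal hx).symm

end
end

section
/- Let π₀, π₁ ∈ 𝒫(𝒳) with π₁ ≪ π₀, L = dπ₁/dπ₀, L_η = L^{1/(1-η)} for η ∈ [0,1), and G = {(1-η)·log 𝔼_{π₀}[L_η] : η ∈ [0,1), 𝔼_{π₀}[L_η] < ∞}. If 1/T ∈ (0, sup G), then there exist η⋆ ∈ (0,1) and a probability measure π⋆ ≪ π₀ such that sup_{π ≪ π₀} 𝔼_{π₁}[(dπ/dπ₀)^{η⋆}] = 𝔼_{π₁}[(dπ⋆/dπ₀)^{η⋆}] = e^{1/T}; moreover dπ⋆/dπ₀ = L_{η⋆}/𝔼_{π₀}[L_{η⋆}] and log(sup_{π ≪ π₀} 𝔼_{π₁}[(dπ/dπ₀)^{η⋆}]) = η⋆ · D_{1/(1-η⋆)}(π₁‖π₀) = 1/T. -/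
open MeasureTheory ProbabilityTheory ENNReal NNReal Set Filter

attribute [local instance] Classical.propDecidable

noncomputable section

/-- The Rényi divergence `D_ξ(π‖π') = (ξ-1)⁻¹ log 𝔼_{π'}[(dπ/dπ')^ξ]` of order `ξ`. -/
def renyiDiv {𝒳 : Type*} [MeasurableSpace 𝒳] (ξ : ℝ) (π π' : Measure 𝒳) : ℝ :=
  (ξ - 1)⁻¹ * Real.log ((∫⁻ x, (π.rnDeriv π' x) ^ ξ ∂π').toReal)

theorem ENNReal.rpow_le_add_rpow_of_mem_Icc (a : ℝ≥0∞) {p q : ℝ} (hp : p ∈ Icc 1 q) :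
    a ^ p ≤ a + a ^ q := by
  rcases le_total a 1 with h | h
  · calc a ^ p ≤ a ^ (1 : ℝ) := ENNReal.rpow_le_rpow_of_exponent_ge h hp.1
      _ = a := ENNReal.rpow_one a
      _ ≤ a + a ^ q := le_self_add
  · exact (ENNReal.rpow_le_rpow_of_exponent_le h hp.2).trans le_add_self

theorem ENNReal.tendsto_const_rpow_of_ne_top {a : ℝ≥0∞} (ha : a ≠ ⊤) {p : ℝ} (hp : 0 < p) :
    Tendsto (fun r : ℝ => a ^ r) (nhds p) (nhds (a ^ p)) := by
  lift a to ℝ≥0 using ha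
  rw [← ENNReal.coe_rpow_of_nonneg a hp.le]
  refine (ENNReal.tendsto_coe.2
    (tendsto_const_nhds.nnrpow tendsto_id (Or.inr hp))).congr' ?_
  filter_upwards [lt_mem_nhds hp] with r hr
  exact ENNReal.coe_rpow_of_nonneg a hr.le

section Moments

variable {α : Type*} [MeasurableSpace α] {μ : Measure α} {f : α → ℝ≥0∞}

theorem lintegral_rpow_ne_top_of_mem_Icc (hf : Measurable f) (hf₁ : ∫⁻ x, f x ∂μ ≠ ⊤) {p q : ℝ}
    (hq : ∫⁻ x, f x ^ q ∂μ ≠ ⊤) (hp : p ∈ Icc 1 q) : ∫⁻ x, f x ^ p ∂μ ≠ ⊤ := by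
  refine ne_top_of_le_ne_top (ENNReal.add_ne_top.2 ⟨hf₁, hq⟩) ?_
  rw [← lintegral_add_left hf]
  exact lintegral_mono fun x => ENNReal.rpow_le_add_rpow_of_mem_Icc (f x) hp

theorem continuousOn_lintegral_rpow (hf : Measurable f) (hf₁ : ∫⁻ x, f x ∂μ ≠ ⊤) {q : ℝ}
    (hq : ∫⁻ x, f x ^ q ∂μ ≠ ⊤) : ContinuousOn (fun p : ℝ => ∫⁻ x, f x ^ p ∂μ) (Icc 1 q) := by
  intro p hp
  refine tendsto_lintegral_filter_of_dominated_convergence (fun x => f x + f x ^ q)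
    (Eventually.of_forall fun r => hf.pow_const r) ?_ ?_ ?_
  · filter_upwards [self_mem_nhdsWithin] with r hr
    exact ae_of_all _ fun x => ENNReal.rpow_le_add_rpow_of_mem_Icc (f x) hr
  · rw [lintegral_add_left hf]
    exact ENNReal.add_ne_top.2 ⟨hf₁, hq⟩
  · filter_upwards [ae_lt_top hf hf₁] with x hx
    exact (ENNReal.tendsto_const_rpow_of_ne_top hx.ne (zero_lt_one.trans_le hp.1)).mono_left
      nhdsWithin_le_nhds

theorem lintegral_rpow_ne_zero (hf : Measurable f) (hf₀ : ∫⁻ x, f x ∂μ ≠ 0) {p : ℝ} (hp : 0 < p) :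
    ∫⁻ x, f x ^ p ∂μ ≠ 0 := by
  contrapose! hf₀
  rw [lintegral_eq_zero_iff (hf.pow_const p)] at hf₀
  rw [lintegral_eq_zero_iff hf]
  filter_upwards [hf₀] with x hx
  exact (ENNReal.rpow_eq_zero_iff_of_pos hp).1 hx

/-- The normalized logarithm `p⁻¹ log ∫ f ^ p` of a probability density `f` vanishes at `p = 1` and
takes every value between `0` and its value at `q`. -/
theorem exists_inv_mul_log_lintegral_rpow_eq (hf : Measurable f) (hf₁ : ∫⁻ x, f x ∂μ = 1)
    {q c : ℝ} (hq₁ : 1 ≤ q) (hq : ∫⁻ x, f x ^ q ∂μ ≠ ⊤) (hc : 0 < c)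
    (hcq : c < q⁻¹ * Real.log (∫⁻ x, f x ^ q ∂μ).toReal) :
    ∃ p ∈ Ioo 1 q, p⁻¹ * Real.log (∫⁻ x, f x ^ p ∂μ).toReal = c := by
  have hf_top : ∫⁻ x, f x ∂μ ≠ ⊤ := by simp [hf₁]
  have hf_zero : ∫⁻ x, f x ∂μ ≠ 0 := by simp [hf₁]
  have hpos : ∀ p ∈ Icc 1 q, 0 < p := fun p hp => zero_lt_one.trans_le hp.1
  have hcont : ContinuousOn (fun p : ℝ => p⁻¹ * Real.log (∫⁻ x, f x ^ p ∂μ).toReal)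
      (Icc 1 q) := by
    refine ContinuousOn.mul (continuousOn_inv₀.mono fun p hp => (hpos p hp).ne') ?_
    refine ContinuousOn.log ?_ fun p hp => ?_
    · exact ENNReal.continuousOn_toReal.comp (continuousOn_lintegral_rpow hf hf_top hq)
        fun p hp => lintegral_rpow_ne_top_of_mem_Icc hf hf_top hq hp
    · exact ENNReal.toReal_ne_zero.2 ⟨lintegral_rpow_ne_zero hf hf_zero (hpos p hp),
        lintegral_rpow_ne_top_of_mem_Icc hf hf_top hq hp⟩
  exact intermediate_value_Ioo hq₁ hcont ⟨by simpa [hf₁] using hc, hcq⟩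

end Moments

section Tilting

variable {α : Type*} [MeasurableSpace α] {μ ν : Measure α}

/-- Hölder's inequality bounds the `η`-moment under `ν` of any density with respect to `μ`. -/
theorem lintegral_rnDeriv_rpow_le [IsFiniteMeasure μ] [IsFiniteMeasure ν] (hνμ : ν ≪ μ) {η : ℝ}
    (hη : η ∈ Ioo (0 : ℝ) 1) (ρ : Measure α) [IsProbabilityMeasure ρ] :
    ∫⁻ x, ρ.rnDeriv μ x ^ η ∂ν ≤ (∫⁻ x, ν.rnDeriv μ x ^ (1 / (1 - η)) ∂μ) ^ (1 - η) := by
  have h1η : 0 < 1 - η := sub_pos.2 hη.2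
  have hconj : (1 / (1 - η)).HolderConjugate (1 / η) := by
    refine Real.holderConjugate_iff.2 ⟨?_, by simp⟩
    rw [lt_div_iff₀ h1η]
    linarith [hη.1]
  have hmeas : Measurable fun x => ρ.rnDeriv μ x ^ η := (Measure.measurable_rnDeriv ρ μ).pow_const η
  have hholder := ENNReal.lintegral_mul_le_Lp_mul_Lq μ hconj
    (Measure.measurable_rnDeriv ν μ).aemeasurable hmeas.aemeasurable
  have hρ : ∫⁻ x, (ρ.rnDeriv μ x ^ η) ^ (1 / η) ∂μ ≤ 1 := by
    simp_rw [← ENNReal.rpow_mul, mul_one_div_cancel hη.1.ne', ENNReal.rpow_one]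
    exact Measure.lintegral_rnDeriv_le.trans_eq measure_univ
  rw [← lintegral_rnDeriv_mul hνμ hmeas.aemeasurable]
  refine hholder.trans ?_
  simp only [one_div_one_div]
  exact mul_le_of_le_one_right' (ENNReal.rpow_le_one hρ hη.1.le)

/-- The escort density `L ^ (1 / (1 - η)) / ∫ L ^ (1 / (1 - η))` attains Hölder's bound. -/
theorem lintegral_escort_rpow_eq [IsFiniteMeasure μ] [IsFiniteMeasure ν] (hνμ : ν ≪ μ) {η : ℝ}
    (hη : η ∈ Ioo (0 : ℝ) 1) {Z : ℝ≥0∞}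
    (hZ : ∫⁻ x, ν.rnDeriv μ x ^ (1 / (1 - η)) ∂μ = Z) (hZ_zero : Z ≠ 0) (hZ_top : Z ≠ ⊤) :
    ∫⁻ x, (ν.rnDeriv μ x ^ (1 / (1 - η)) / Z) ^ η ∂ν = Z ^ (1 - η) := by
  have h1η : 0 < 1 - η := sub_pos.2 hη.2
  have hL := Measure.measurable_rnDeriv ν μ
  have hmeas : Measurable fun x => (ν.rnDeriv μ x ^ (1 / (1 - η)) / Z) ^ η :=
    ((hL.pow_const _).div_const Z).pow_const η
  have hexp : 1 + 1 / (1 - η) * η = 1 / (1 - η) := by field_simp; ring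
  have hint : ∀ x, ν.rnDeriv μ x * (ν.rnDeriv μ x ^ (1 / (1 - η)) / Z) ^ η
      = ν.rnDeriv μ x ^ (1 / (1 - η)) * (Z ^ η)⁻¹ := fun x => by
    rw [ENNReal.div_rpow_of_nonneg _ _ hη.1.le, ← ENNReal.rpow_mul, div_eq_mul_inv, ← mul_assoc]
    nth_rewrite 1 [← ENNReal.rpow_one (ν.rnDeriv μ x)]
    rw [← ENNReal.rpow_add_of_nonneg _ _ zero_le_one
      (mul_nonneg (one_div_pos.2 h1η).le hη.1.le), hexp]
  rw [← lintegral_rnDeriv_mul hνμ hmeas.aemeasurable]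
  simp_rw [hint]
  rw [lintegral_mul_const _ (hL.pow_const _), hZ, ENNReal.rpow_sub _ _ hZ_zero hZ_top,
    ENNReal.rpow_one, div_eq_mul_inv]

end Tilting

theorem edo_criterion_exists
    (𝒳 : Type*) [MeasurableSpace 𝒳] [StandardBorelSpace 𝒳]
    (π₀ π₁ : Measure 𝒳) [IsProbabilityMeasure π₀] [IsProbabilityMeasure π₁]
    (hac : π₁ ≪ π₀) (T : ℝ) (hT : 0 < T)
    -- `1/T ∈ (0, sup G)`, i.e. some element of `G` exceeds `1/T`
    (hG : ∃ η ∈ Set.Ico (0 : ℝ) 1,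
      (∫⁻ x, (π₁.rnDeriv π₀ x) ^ (1 / (1 - η)) ∂π₀) ≠ ⊤ ∧
      1 / T < (1 - η) *
        Real.log ((∫⁻ x, (π₁.rnDeriv π₀ x) ^ (1 / (1 - η)) ∂π₀).toReal)) :
    ∃ ηstar ∈ Set.Ioo (0 : ℝ) 1, ∃ πstar : Measure 𝒳,
      IsProbabilityMeasure πstar ∧ πstar ≪ π₀ ∧
      (⨆ (π : Measure 𝒳) (_ : IsProbabilityMeasure π) (_ : π ≪ π₀),
          ∫⁻ x, (π.rnDeriv π₀ x) ^ ηstar ∂π₁)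
        = ∫⁻ x, (πstar.rnDeriv π₀ x) ^ ηstar ∂π₁ ∧
      (∫⁻ x, (πstar.rnDeriv π₀ x) ^ ηstar ∂π₁) = ENNReal.ofReal (Real.exp (1 / T)) ∧
      (πstar.rnDeriv π₀ =ᵐ[π₀] fun x => (π₁.rnDeriv π₀ x) ^ (1 / (1 - ηstar))
          / ∫⁻ y, (π₁.rnDeriv π₀ y) ^ (1 / (1 - ηstar)) ∂π₀) ∧
      ηstar * renyiDiv (1 / (1 - ηstar)) π₁ π₀ = 1 / T ∧
      Real.log ((⨆ (π : Measure 𝒳) (_ : IsProbabilityMeasure π) (_ : π ≪ π₀),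
          ∫⁻ x, (π.rnDeriv π₀ x) ^ ηstar ∂π₁).toReal) = 1 / T := by
  obtain ⟨η, hη, hη_top, hη_lt⟩ := hG
  have hL := Measure.measurable_rnDeriv π₁ π₀
  have hL₁ : ∫⁻ x, π₁.rnDeriv π₀ x ∂π₀ = 1 := by
    rw [Measure.lintegral_rnDeriv hac, measure_univ]
  have hq₁ : 1 ≤ 1 / (1 - η) := by
    rw [le_div_iff₀ (sub_pos.2 hη.2)]
    linarith [hη.1]
  obtain ⟨p, hp, hpT⟩ := exists_inv_mul_log_lintegral_rpow_eq hL hL₁ hq₁ hη_top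
    (one_div_pos.2 hT) (by rwa [one_div (1 - η), inv_inv, ← one_div (1 - η)])
  have hp_pos : 0 < p := zero_lt_one.trans hp.1
  have hηstar : 1 - p⁻¹ ∈ Ioo (0 : ℝ) 1 :=
    ⟨sub_pos.2 (inv_lt_one_of_one_lt₀ hp.1), sub_lt_self _ (inv_pos.2 hp_pos)⟩
  have hexp : 1 / (1 - (1 - p⁻¹)) = p := by simp
  set Z := ∫⁻ x, π₁.rnDeriv π₀ x ^ p ∂π₀ with hZ
  have hZ_top : Z ≠ ⊤ := lintegral_rpow_ne_top_of_mem_Icc hL (by simp [hL₁]) hη_top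
    (Ioo_subset_Icc_self hp)
  have hZ_zero : Z ≠ 0 := lintegral_rpow_ne_zero hL (by simp [hL₁]) hp_pos
  have hZ_val : Z ^ (1 - (1 - p⁻¹)) = ENNReal.ofReal (Real.exp (1 / T)) := by
    rw [← ENNReal.ofReal_toReal (ENNReal.rpow_ne_top_of_ne_zero hZ_zero hZ_top),
      ← ENNReal.toReal_rpow, Real.rpow_def_of_pos (ENNReal.toReal_pos hZ_zero hZ_top), ← hpT]
    congr 2
    ring
  have hdens : Measurable fun x => π₁.rnDeriv π₀ x ^ p / Z := (hL.pow_const p).div_const Z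
  have hrn := Measure.rnDeriv_withDensity π₀ hdens
  have hprob : IsProbabilityMeasure (π₀.withDensity fun x => π₁.rnDeriv π₀ x ^ p / Z) := by
    refine ⟨?_⟩
    simp_rw [withDensity_apply _ MeasurableSet.univ, Measure.restrict_univ, div_eq_mul_inv]
    rw [lintegral_mul_const _ (hL.pow_const p), ← hZ, ENNReal.mul_inv_cancel hZ_zero hZ_top]
  have hstar_ac : (π₀.withDensity fun x => π₁.rnDeriv π₀ x ^ p / Z) ≪ π₀ :=
    withDensity_absolutelyContinuous _ _
  have hstar_val : ∫⁻ x, ((π₀.withDensity fun x => π₁.rnDeriv π₀ x ^ p / Z).rnDeriv π₀ x)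
      ^ (1 - p⁻¹) ∂π₁ = ENNReal.ofReal (Real.exp (1 / T)) := by
    have hattain := lintegral_escort_rpow_eq hac hηstar (Z := Z) (by rw [hexp]) hZ_zero hZ_top
    rw [hexp] at hattain
    rw [← hZ_val, ← hattain]
    refine lintegral_congr_ae ?_
    filter_upwards [hac.ae_le hrn] with x hx
    rw [hx]
  have hsup : (⨆ (π : Measure 𝒳) (_ : IsProbabilityMeasure π) (_ : π ≪ π₀),
      ∫⁻ x, (π.rnDeriv π₀ x) ^ (1 - p⁻¹) ∂π₁) = ENNReal.ofReal (Real.exp (1 / T)) := by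
    refine le_antisymm (iSup_le fun π => iSup_le fun _ => iSup_le fun _ => ?_) ?_
    · have hle := lintegral_rnDeriv_rpow_le hac hηstar π
      rwa [hexp, ← hZ, hZ_val] at hle
    · rw [← hstar_val]
      exact le_iSup_of_le _ (le_iSup_of_le hprob (le_iSup_of_le hstar_ac le_rfl))
  refine ⟨1 - p⁻¹, hηstar, _, hprob, hstar_ac, hsup.trans hstar_val.symm, hstar_val, ?_, ?_, ?_⟩
  · rw [hexp]
    exact hrn
  · rw [renyiDiv, hexp, ← hpT, ← hZ]
    have : p - 1 ≠ 0 := (sub_pos.2 hp.1).ne'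
    field_simp
  · rw [hsup, ENNReal.toReal_ofReal (Real.exp_pos _).le, Real.log_exp]

end
end

section
/- Fix a ∈ 𝒜 with φ(a,·) > 0 π₁-almost surely, and assume γ(a) = 𝔼_{π₁}[log φ(a,·)] ∈ [-∞,∞] is well-defined. Then the constant policy always playing a rejects with probability one from every starting wealth w ∈ (0, α^{-1}) — i.e., π₁^⊗(τ_w^a < ∞) = 1 for every w ∈ (0, α^{-1}) — if and only if either γ(a) > 0, or γ(a) = 0 and π₁(log φ(a,·) > 0) > 0. -/
open MeasureTheory ProbabilityTheory ENNReal NNReal Set Filter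

attribute [local instance] Classical.propDecidable

noncomputable section

variable {𝒳 𝒜 : Type*} [MeasurableSpace 𝒳] [MeasurableSpace 𝒜]

/-- Wealth of the constant policy that always plays the action `a`. -/
def constWealth (φ : 𝒜 → 𝒳 → ℝ≥0) (a : 𝒜) : ℕ → (ℕ → 𝒳) → ℝ≥0
  | 0, _ => 1
  | n + 1, x => constWealth φ a n x * φ a (x n)

section BirkhoffSum

variable {Ω : Type*} {θ : Ω → Ω} {g : Ω → ℝ} {δ : ℝ}

/-- If the Birkhoff sums of `g` along the orbit of `x` are bounded above by `K`, the number of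
visits to the set where all later sums stay below `-δ` is controlled by `K - birkhoffSum θ g n x`. -/
lemma mul_birkhoffSum_indicator_le (n : ℕ) (x : Ω) (K : ℝ)
    (hK : ∀ j, birkhoffSum θ g j x ≤ K) :
    δ * birkhoffSum θ ({y | ∀ j, birkhoffSum θ g (j + 1) y ≤ -δ}.indicator fun _ => (1 : ℝ)) n x
      ≤ K - birkhoffSum θ g n x := by
  induction n generalizing x K with
  | zero => simpa using hK 0
  | succ n ih =>
    have hK0 : 0 ≤ K := by simpa using hK 0
    rw [birkhoffSum_succ', birkhoffSum_succ' (g := g)]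
    by_cases hx : ∀ j, birkhoffSum θ g (j + 1) x ≤ -δ
    · rw [indicator_of_mem (by exact hx)]
      have := ih (θ x) (-δ - g x) fun j => by
        have := hx j
        rw [birkhoffSum_succ'] at this
        linarith
      linarith
    · rw [indicator_of_notMem (by exact hx)]
      have := ih (θ x) (K - g x) fun j => by
        have := hK (j + 1)
        rw [birkhoffSum_succ'] at this
        linarith
      linarith

/-- Upper boundedness of Birkhoff sums passes from any point of the orbit to its start. -/
lemma exists_birkhoffSum_le_of_iterate (k : ℕ) (x : Ω) (K : ℝ)
    (hK : ∀ j, birkhoffSum θ g j (θ^[k] x) ≤ K) :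
    ∃ K', ∀ j, birkhoffSum θ g j x ≤ K' := by
  induction k generalizing x K with
  | zero => exact ⟨K, by simpa using hK⟩
  | succ k ih =>
    obtain ⟨K', hK'⟩ := ih (θ x) K (by simpa using hK)
    refine ⟨max 0 (g x + K'), fun j => ?_⟩
    cases j with
    | zero => simp
    | succ j =>
      rw [birkhoffSum_succ']
      exact le_max_of_le_right (by linarith [hK' j])

lemma birkhoffSum_measurable [MeasurableSpace Ω] (hθ : Measurable θ) (hg : Measurable g) (n : ℕ) :
    Measurable (birkhoffSum θ g n) := by
  unfold birkhoffSum
  exact Finset.measurable_sum _ fun k _ => hg.comp (hθ.iterate k)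

/-- If the Birkhoff averages of `g` vanish asymptotically, then almost surely the Birkhoff sums
return above any negative level. -/
lemma ae_exists_neg_lt_birkhoffSum [MeasurableSpace Ω] {P : Measure Ω} [IsProbabilityMeasure P]
    (hθ : MeasurePreserving θ P P) (hg : Measurable g) (hδ : 0 < δ)
    (hlim : ∀ᵐ x ∂P, Tendsto (fun n : ℕ => birkhoffSum θ g n x / n) atTop (nhds 0)) :
    ∀ᵐ x ∂P, ∃ j, -δ < birkhoffSum θ g (j + 1) x := by
  set B : Set Ω := {y | ∀ j, birkhoffSum θ g (j + 1) y ≤ -δ} with hB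
  have hBm : MeasurableSet B := by
    rw [hB, ofPred_forall]
    exact MeasurableSet.iInter fun j =>
      measurableSet_le (birkhoffSum_measurable hθ.measurable hg _) measurable_const
  set T : ℕ → Ω → ℝ := fun n => birkhoffSum θ (B.indicator fun _ => (1 : ℝ)) n with hT
  have hTm (n : ℕ) : Measurable (T n) :=
    birkhoffSum_measurable hθ.measurable (measurable_const.indicator hBm) n
  have hT0 (n : ℕ) (x : Ω) : 0 ≤ T n x :=
    Finset.sum_nonneg fun k _ => indicator_nonneg (fun _ _ => zero_le_one) _
  have hTn (n : ℕ) (x : Ω) : T n x ≤ n := by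
    calc T n x ≤ ∑ _k ∈ Finset.range n, (1 : ℝ) :=
          Finset.sum_le_sum fun k _ => indicator_le_self' (fun _ _ => zero_le_one) _
      _ = n := by simp
  have hTlim : ∀ᵐ x ∂P, Tendsto (fun n : ℕ => T n x / n) atTop (nhds 0) := by
    filter_upwards [hlim] with x hx
    by_cases hbd : ∃ K, ∀ j, birkhoffSum θ g j x ≤ K
    · obtain ⟨K, hK⟩ := hbd
      have hup : Tendsto (fun n : ℕ => (K / n - birkhoffSum θ g n x / n) / δ) atTop (nhds 0) := by
        simpa using ((tendsto_const_div_atTop_nhds_zero_nat K).sub hx).div_const δ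
      refine squeeze_zero (fun n => div_nonneg (hT0 n x) n.cast_nonneg) (fun n => ?_) hup
      have := mul_birkhoffSum_indicator_le (δ := δ) n x K hK
      rw [← _root_.sub_div, le_div_iff₀ hδ, div_mul_eq_mul_div]
      gcongr
      rw [mul_comm]
      exact this
    · have hz (n : ℕ) : T n x = 0 := by
        refine Finset.sum_eq_zero fun k _ => indicator_of_notMem (fun hk => hbd ?_) _
        refine exists_birkhoffSum_le_of_iterate k x 0 fun j => ?_
        cases j with
        | zero => simp
        | succ j => exact (hk j).trans (by linarith)
      simp [hz]
  have hmean (n : ℕ) : ∫ x, T (n + 1) x / (n + 1 : ℕ) ∂P = P.real B := by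
    have hint (k : ℕ) : ∫ x, B.indicator (fun _ => (1 : ℝ)) (θ^[k] x) ∂P = P.real B := by
      rw [← integral_indicator_one hBm]
      have := integral_map (μ := P) (hθ.iterate k).measurable.aemeasurable
        (f := B.indicator fun _ => (1 : ℝ))
        (measurable_const.indicator hBm).aestronglyMeasurable
      rw [(hθ.iterate k).map_eq] at this
      exact this.symm
    rw [integral_div]
    simp only [hT, birkhoffSum]
    rw [integral_finsetSum]
    · simp only [hint, Finset.sum_const, Finset.card_range, nsmul_eq_mul]
      field_simp
    · intro k _
      exact (hθ.iterate k).integrable_comp_of_integrable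
        ((integrable_const (1 : ℝ)).indicator hBm)
  have hdom : Tendsto (fun n : ℕ => ∫ x, T (n + 1) x / (n + 1 : ℕ) ∂P) atTop
      (nhds (∫ _, (0 : ℝ) ∂P)) := by
    refine tendsto_integral_of_dominated_convergence (fun _ => 1)
      (fun n => ((hTm _).div_const _).aestronglyMeasurable) (integrable_const _)
      (fun n => ae_of_all _ fun x => ?_) ?_
    · rw [Real.norm_of_nonneg (div_nonneg (hT0 _ x) (Nat.cast_nonneg _))]
      exact div_le_one_of_le₀ (hTn _ x) (Nat.cast_nonneg _)
    · filter_upwards [hTlim] with x hx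
      exact hx.comp (tendsto_add_atTop_nat 1)
  simp only [hmean, integral_zero, tendsto_const_nhds_iff] at hdom
  have hB0 : P B = 0 := (measureReal_eq_zero_iff).1 hdom
  filter_upwards [measure_eq_zero_iff_ae_notMem.1 hB0] with x hx
  simpa [hB] using hx

/-- If almost surely the Birkhoff sums exceed a fixed positive level, they are almost surely
unbounded above. -/
lemma ae_forall_exists_le_birkhoffSum [MeasurableSpace Ω] {P : Measure Ω}
    (hθ : MeasurePreserving θ P P) (hδ : 0 < δ)
    (h : ∀ᵐ x ∂P, ∃ j, δ < birkhoffSum θ g j x) :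
    ∀ᵐ x ∂P, ∀ c : ℝ, ∃ n, c ≤ birkhoffSum θ g n x := by
  have hall : ∀ᵐ x ∂P, ∀ k, ∃ j, δ < birkhoffSum θ g j (θ^[k] x) :=
    ae_all_iff.2 fun k => (hθ.iterate k).quasiMeasurePreserving.ae h
  filter_upwards [hall] with x hx c
  have hm (m : ℕ) : ∃ n, m * δ ≤ birkhoffSum θ g n x := by
    induction m with
    | zero => exact ⟨0, by simp⟩
    | succ m ih =>
      obtain ⟨n, hn⟩ := ih
      obtain ⟨j, hj⟩ := hx n
      refine ⟨n + j, ?_⟩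
      rw [birkhoffSum_add]
      push_cast
      linarith
  obtain ⟨m, hm'⟩ := exists_nat_ge (c / δ)
  obtain ⟨n, hn⟩ := hm m
  exact ⟨n, ((div_le_iff₀ hδ).1 hm').trans hn⟩

end BirkhoffSum

section RandomWalk

/-- The left shift on sequences. -/
def seqShift (x : ℕ → 𝒳) : ℕ → 𝒳 := fun n => x (n + 1)

/-- Prepend a point to a sequence. -/
def seqCons (p : 𝒳 × (ℕ → 𝒳)) : ℕ → 𝒳
  | 0 => p.1
  | n + 1 => p.2 n

lemma measurable_seqCons : Measurable (seqCons : 𝒳 × (ℕ → 𝒳) → ℕ → 𝒳) := by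
  refine measurable_pi_iff.2 fun n => ?_
  cases n with
  | zero => exact measurable_fst
  | succ n => exact (measurable_pi_apply n).comp measurable_snd

lemma measurable_seqShift : Measurable (seqShift : (ℕ → 𝒳) → ℕ → 𝒳) :=
  measurable_pi_iff.2 fun n => measurable_pi_apply (n + 1)

lemma seqShift_iterate_apply {E : Type*} (k n : ℕ) (x : ℕ → E) : seqShift^[k] x n = x (n + k) := by
  induction k generalizing x with
  | zero => rfl
  | succ k ih =>
    rw [Function.iterate_succ_apply, ih]
    simp only [seqShift]
    congr 1

lemma birkhoffSum_seqShift {E : Type*} (f : E → ℝ) (n : ℕ) (x : ℕ → E) :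
    birkhoffSum seqShift (fun y => f (y 0)) n x = ∑ i ∈ Finset.range n, f (x i) := by
  simp [birkhoffSum, seqShift_iterate_apply]

variable (π : Measure 𝒳) [IsProbabilityMeasure π]

lemma measurePreserving_seqCons :
    MeasurePreserving seqCons (π.prod (Measure.infinitePi fun _ : ℕ => π))
      (Measure.infinitePi fun _ : ℕ => π) := by
  refine ⟨measurable_seqCons, Measure.eq_infinitePi _ fun s t ht => ?_⟩
  obtain ⟨N, hN⟩ := s.exists_nat_subset_range
  set u : ℕ → Set 𝒳 := fun i => if i ∈ s then t i else univ with hu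
  have hum (i : ℕ) : MeasurableSet (u i) := by
    simp only [hu]
    split_ifs
    exacts [ht i, .univ]
  have hpi : (s : Set ℕ).pi t = ((Finset.range (N + 1) : Finset ℕ) : Set ℕ).pi u := by
    ext x
    simp only [Set.mem_pi, Finset.mem_coe, hu, Finset.mem_range]
    refine ⟨fun h i _ => ?_, fun h i hi => ?_⟩
    · split_ifs with his
      exacts [h i his, mem_univ _]
    · have := Finset.mem_range.1 (hN hi)
      simpa [hi] using h i (by omega)
  have hpre : seqCons ⁻¹' ((Finset.range (N + 1) : Finset ℕ) : Set ℕ).pi u =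
      u 0 ×ˢ ((Finset.range N : Finset ℕ) : Set ℕ).pi fun i => u (i + 1) := by
    ext p
    simp only [mem_preimage, Set.mem_pi, Finset.mem_coe, Finset.mem_range, mem_prod]
    refine ⟨fun h => ⟨h 0 (by omega), fun i hi => h (i + 1) (by omega)⟩, fun h i hi => ?_⟩
    cases i with
    | zero => exact h.1
    | succ i => exact h.2 i (by omega)
  have hprod : ∏ i ∈ s, π (t i) = ∏ i ∈ Finset.range (N + 1), π (u i) := by
    rw [← Finset.prod_subset (hN.trans (Finset.range_mono (Nat.le_succ N)))]
    · exact Finset.prod_congr rfl fun i hi => by simp [hu, hi]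
    · intro i _ hi
      simp [hu, hi]
  rw [hprod, hpi, Measure.map_apply measurable_seqCons
    (.pi (Finset.countable_toSet _) fun _ _ => hum _), hpre, Measure.prod_prod,
    Measure.infinitePi_pi _ (fun i _ => hum (i + 1)), Finset.prod_range_succ', mul_comm]

lemma measurePreserving_seqShift :
    MeasurePreserving seqShift (Measure.infinitePi fun _ : ℕ => π)
      (Measure.infinitePi fun _ : ℕ => π) := by
  refine ⟨measurable_seqShift, ?_⟩
  conv_lhs => rw [← (measurePreserving_seqCons π).map_eq]
  rw [Measure.map_map measurable_seqShift measurable_seqCons]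
  exact (measurePreserving_snd (μ := π)).map_eq

variable {π}

lemma ae_tendsto_sum_div {f : 𝒳 → ℝ} (hf : Measurable f) (hint : Integrable f π) :
    ∀ᵐ x ∂(Measure.infinitePi fun _ : ℕ => π),
      Tendsto (fun n : ℕ => (∑ i ∈ Finset.range n, f (x i)) / n) atTop (nhds (∫ y, f y ∂π)) := by
  have heval (i : ℕ) : MeasurePreserving (fun x : ℕ → 𝒳 => x i)
      (Measure.infinitePi fun _ : ℕ => π) π := measurePreserving_eval_infinitePi _ i
  have h := strong_law_ae_real (μ := Measure.infinitePi fun _ : ℕ => π)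
    (fun i x => f (x i)) ((heval 0).integrable_comp_of_integrable hint)
    (fun i j hij => (iIndepFun_infinitePi (P := fun _ : ℕ => π) (X := fun _ => f)
      fun _ => hf).indepFun hij)
    (fun i => ⟨(hf.comp (heval i).measurable).aemeasurable,
      (hf.comp (heval 0).measurable).aemeasurable, by
        change Measure.map (f ∘ fun x : ℕ → 𝒳 => x i) _ = Measure.map (f ∘ fun x : ℕ → 𝒳 => x 0) _
        rw [← Measure.map_map hf (heval i).measurable, ← Measure.map_map hf (heval 0).measurable,
          (heval i).map_eq, (heval 0).map_eq]⟩)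
  have hmean : ∫ x, f (x 0) ∂(Measure.infinitePi fun _ : ℕ => π) = ∫ y, f y ∂π := by
    have := integral_map (μ := Measure.infinitePi fun _ : ℕ => π)
      (heval 0).measurable.aemeasurable (f := f) hf.aestronglyMeasurable
    rw [(heval 0).map_eq] at this
    exact this.symm
  simpa only [hmean] using h

/-- An integrable real function from finiteness of the integrals of its two parts. -/
lemma integrable_of_lintegral_ofReal_ne_top {π : Measure 𝒳} {f : 𝒳 → ℝ} (hf : Measurable f)
    (hp : ∫⁻ x, ENNReal.ofReal (f x) ∂π ≠ ⊤) (hn : ∫⁻ x, ENNReal.ofReal (-f x) ∂π ≠ ⊤) :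
    Integrable f π := by
  refine ⟨hf.aestronglyMeasurable, ?_⟩
  rw [hasFiniteIntegral_iff_norm]
  have hle (x : 𝒳) : ENNReal.ofReal ‖f x‖ ≤ ENNReal.ofReal (f x) + ENNReal.ofReal (-f x) := by
    rcases le_total 0 (f x) with h | h
    · rw [Real.norm_of_nonneg h]
      exact le_self_add
    · rw [Real.norm_of_nonpos h]
      exact le_add_self
  calc ∫⁻ x, ENNReal.ofReal ‖f x‖ ∂π
      ≤ ∫⁻ x, (ENNReal.ofReal (f x) + ENNReal.ofReal (-f x)) ∂π := lintegral_mono hle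
    _ = ∫⁻ x, ENNReal.ofReal (f x) ∂π + ∫⁻ x, ENNReal.ofReal (-f x) ∂π :=
        lintegral_add_left (by fun_prop) _
    _ < ⊤ := ENNReal.add_lt_top.2 ⟨hp.lt_top, hn.lt_top⟩

/-- A random walk whose (possibly infinite) drift is positive tends to `+∞`. -/
lemma ae_tendsto_sum_atTop {f : 𝒳 → ℝ} (hf : Measurable f)
    (hlt : ∫⁻ x, ENNReal.ofReal (-f x) ∂π < ∫⁻ x, ENNReal.ofReal (f x) ∂π) :
    ∀ᵐ x ∂(Measure.infinitePi fun _ : ℕ => π),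
      Tendsto (fun n : ℕ => ∑ i ∈ Finset.range n, f (x i)) atTop atTop := by
  have hsup : ∫⁻ x, ENNReal.ofReal (f x) ∂π =
      ⨆ M : ℕ, ∫⁻ x, ENNReal.ofReal (min (f x) M) ∂π := by
    rw [← lintegral_iSup (fun M => by fun_prop)]
    · refine lintegral_congr fun x => le_antisymm ?_ (iSup_le fun M => ?_)
      · obtain ⟨M, hM⟩ := exists_nat_ge (f x)
        exact le_iSup_of_le M (by rw [min_eq_left hM])
      · exact ENNReal.ofReal_le_ofReal (min_le_left _ _)
    · intro M N hMN x
      exact ENNReal.ofReal_le_ofReal (min_le_min_left _ (Nat.cast_le.2 hMN))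
  obtain ⟨M, hM⟩ := lt_iSup_iff.1 (hsup ▸ hlt)
  set h : 𝒳 → ℝ := fun x => min (f x) M with hh
  have hhm : Measurable h := hf.min measurable_const
  have hneg (x : 𝒳) : ENNReal.ofReal (-h x) = ENNReal.ofReal (-f x) := by
    rcases le_total (f x) M with hx | hx
    · simp only [hh, min_eq_left hx]
    · have h0 : (0 : ℝ) ≤ M := M.cast_nonneg
      simp only [hh, min_eq_right hx]
      rw [ENNReal.ofReal_of_nonpos (by linarith), ENNReal.ofReal_of_nonpos (by linarith)]
  have hfinp : ∫⁻ x, ENNReal.ofReal (h x) ∂π ≠ ⊤ := by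
    refine ne_top_of_le_ne_top (b := ∫⁻ _, ENNReal.ofReal M ∂π) (by simp) ?_
    exact lintegral_mono fun x => ENNReal.ofReal_le_ofReal (min_le_right _ _)
  have hfinn : ∫⁻ x, ENNReal.ofReal (-h x) ∂π ≠ ⊤ := by
    simp only [hneg]
    exact hlt.ne_top
  have hint := integrable_of_lintegral_ofReal_ne_top hhm hfinp hfinn
  have hpos : 0 < ∫ x, h x ∂π := by
    rw [integral_eq_lintegral_pos_part_sub_lintegral_neg_part hint, sub_pos]
    simp only [hneg]
    exact (ENNReal.toReal_lt_toReal hlt.ne_top hfinp).2 hM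
  filter_upwards [ae_tendsto_sum_div hhm hint] with x hx
  have hinf : Tendsto (fun n : ℕ => ∑ i ∈ Finset.range n, h (x i)) atTop atTop := by
    refine (hx.pos_mul_atTop hpos tendsto_natCast_atTop_atTop).congr' ?_
    filter_upwards [eventually_gt_atTop 0] with n hn
    have : (n : ℝ) ≠ 0 := by positivity
    field_simp
  exact tendsto_atTop_mono (fun n => Finset.sum_le_sum fun i _ => min_le_left _ _) hinf

/-- A centered nondegenerate random walk is almost surely unbounded above. -/
lemma ae_unbounded_sum_of_integral_eq_zero {f : 𝒳 → ℝ} (hf : Measurable f)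
    (hint : Integrable f π) (hmean : ∫ x, f x ∂π = 0) (hneg : 0 < π {x | f x < 0}) :
    ∀ᵐ x ∂(Measure.infinitePi fun _ : ℕ => π),
      ∀ c : ℝ, ∃ n : ℕ, c ≤ ∑ i ∈ Finset.range n, f (x i) := by
  set P : Measure (ℕ → 𝒳) := Measure.infinitePi fun _ : ℕ => π with hP
  set g : (ℕ → 𝒳) → ℝ := fun y => f (y 0) with hg
  have hgm : Measurable g := hf.comp (measurable_pi_apply 0)
  have hθ : MeasurePreserving seqShift P P := measurePreserving_seqShift π
  obtain ⟨δ, hδ, hπδ⟩ : ∃ δ : ℝ, 0 < δ ∧ π {x | f x ≤ -(2 * δ)} ≠ 0 := by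
    by_contra! hcon
    have hnull : π (⋃ m : ℕ, {x | f x ≤ -(2 * (1 / ((m : ℝ) + 1)))}) = 0 :=
      measure_iUnion_null fun m => hcon _ (by positivity)
    refine hneg.ne' (measure_mono_null (fun x hx => ?_) hnull)
    obtain ⟨m, hm⟩ := exists_nat_one_div_lt (show 0 < -f x / 2 by
      have : f x < 0 := hx
      linarith)
    exact mem_iUnion.2 ⟨m, show f x ≤ _ by linarith⟩
  have hlim : ∀ᵐ x ∂P, Tendsto (fun n : ℕ => birkhoffSum seqShift g n x / n) atTop (nhds 0) := by
    simpa only [hg, birkhoffSum_seqShift, hmean] using ae_tendsto_sum_div hf hint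
  have hret := ae_exists_neg_lt_birkhoffSum hθ hgm hδ hlim
  set C : Set (ℕ → 𝒳) := {y | ∀ j, birkhoffSum seqShift g j y ≤ δ} with hC
  have hprod : (π.prod P) ({x | f x ≤ -(2 * δ)} ×ˢ C) = 0 := by
    refine measure_mono_null ?_
      (ae_iff.1 ((measurePreserving_seqCons π).quasiMeasurePreserving.ae hret))
    rintro ⟨a, y⟩ ⟨ha, hy⟩
    simp only [mem_ofPred_eq, not_exists, not_lt]
    intro j
    rw [birkhoffSum_succ']
    have h1 : g (seqCons (a, y)) ≤ -(2 * δ) := ha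
    have h2 : birkhoffSum seqShift g j (seqShift (seqCons (a, y))) ≤ δ := hy j
    linarith
  rw [Measure.prod_prod, mul_eq_zero, or_iff_right hπδ] at hprod
  have hexc : ∀ᵐ x ∂P, ∃ j, δ < birkhoffSum seqShift g j x := by
    filter_upwards [measure_eq_zero_iff_ae_notMem.1 hprod] with x hx
    simpa [hC] using hx
  simpa only [hg, birkhoffSum_seqShift] using ae_forall_exists_le_birkhoffSum hθ hδ hexc

/-- A random walk with a well-defined drift is almost surely unbounded above exactly when its
drift is positive, or vanishes without the step being almost surely nonpositive. -/
lemma ae_unbounded_sum_iff {f : 𝒳 → ℝ} (hf : Measurable f)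
    (hwd : ∫⁻ x, ENNReal.ofReal (f x) ∂π ≠ ⊤ ∨ ∫⁻ x, ENNReal.ofReal (-f x) ∂π ≠ ⊤) :
    (∀ᵐ x ∂(Measure.infinitePi fun _ : ℕ => π),
        ∀ c : ℝ, ∃ n : ℕ, c ≤ ∑ i ∈ Finset.range n, f (x i)) ↔
      (∫⁻ x, ENNReal.ofReal (-f x) ∂π < ∫⁻ x, ENNReal.ofReal (f x) ∂π ∨
        (∫⁻ x, ENNReal.ofReal (f x) ∂π = ∫⁻ x, ENNReal.ofReal (-f x) ∂π ∧
          0 < π {x | 0 < f x})) := by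
  constructor
  · intro h
    rcases lt_trichotomy (∫⁻ x, ENNReal.ofReal (-f x) ∂π) (∫⁻ x, ENNReal.ofReal (f x) ∂π)
      with hlt | heq | hgt
    · exact Or.inl hlt
    · refine Or.inr ⟨heq.symm, pos_iff_ne_zero.2 fun h0 => ?_⟩
      have hall : ∀ᵐ x ∂(Measure.infinitePi fun _ : ℕ => π), ∀ i, x i ∉ {y | 0 < f y} :=
        ae_all_iff.2 fun i => (measurePreserving_eval_infinitePi (fun _ : ℕ => π) i
          ).quasiMeasurePreserving.ae (measure_eq_zero_iff_ae_notMem.1 h0)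
      obtain ⟨x, hx, hx0⟩ := (h.and hall).exists
      obtain ⟨n, hn⟩ := hx 1
      have : ∑ i ∈ Finset.range n, f (x i) ≤ 0 :=
        Finset.sum_nonpos fun i _ => not_lt.1 (hx0 i)
      linarith
    · have hbot := ae_tendsto_sum_atTop (π := π) hf.neg (by simpa using hgt)
      obtain ⟨x, hx, hxb⟩ := (h.and hbot).exists
      obtain ⟨K, hK⟩ := bddBelow_range_of_tendsto_atTop_atTop hxb
      obtain ⟨n, hn⟩ := hx (-K + 1)
      have : K ≤ ∑ i ∈ Finset.range n, (-f) (x i) := hK (mem_range_self n)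
      simp only [Pi.neg_apply, Finset.sum_neg_distrib] at this
      linarith
  · rintro (hlt | ⟨heq, hpos⟩)
    · filter_upwards [ae_tendsto_sum_atTop hf hlt] with x hx c
      exact (hx.eventually_ge_atTop c).exists
    · have hfin : ∫⁻ x, ENNReal.ofReal (f x) ∂π ≠ ⊤ := hwd.elim id fun h => heq ▸ h
      have hint := integrable_of_lintegral_ofReal_ne_top hf hfin (heq ▸ hfin)
      refine ae_unbounded_sum_of_integral_eq_zero hf hint ?_ ?_
      · rw [integral_eq_lintegral_pos_part_sub_lintegral_neg_part hint, heq, sub_self]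
      · refine pos_iff_ne_zero.2 fun h0 => hpos.ne' ?_
        have hz : ∫⁻ x, ENNReal.ofReal (f x) ∂π = 0 := by
          rw [heq, lintegral_eq_zero_iff (by fun_prop)]
          filter_upwards [measure_eq_zero_iff_ae_notMem.1 h0] with x hx
          have : 0 ≤ f x := not_lt.1 hx
          simpa using this
        rw [lintegral_eq_zero_iff (by fun_prop)] at hz
        refine measure_eq_zero_iff_ae_notMem.2 ?_
        filter_upwards [hz] with x hx
        simpa using hx

end RandomWalk

lemma IsIIDProduct.eq_infinitePi {π : Measure 𝒳} [IsProbabilityMeasure π]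
    {P : Measure (ℕ → 𝒳)} (hP : IsIIDProduct π P) : P = Measure.infinitePi fun _ : ℕ => π := by
  refine Measure.eq_infinitePi _ fun s t ht => ?_
  obtain ⟨N, hN⟩ := s.exists_nat_subset_range
  set u : ℕ → Set 𝒳 := fun i => if i ∈ s then t i else univ with hu
  have hum (i : ℕ) : MeasurableSet (u i) := by
    simp only [hu]
    split_ifs
    exacts [ht i, .univ]
  have hpi : (s : Set ℕ).pi t =
      (fun x (i : Fin N) => x i.val) ⁻¹' univ.pi fun i : Fin N => u i := by
    ext x
    simp only [Set.mem_pi, Finset.mem_coe, hu, mem_preimage, mem_univ, true_imp_iff]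
    refine ⟨fun h i => ?_, fun h i hi => ?_⟩
    · split_ifs with his
      exacts [h i his, mem_univ _]
    · simpa [hi] using h ⟨i, Finset.mem_range.1 (hN hi)⟩
  rw [hpi, ← Measure.map_apply (by fun_prop) (.univ_pi fun i : Fin N => hum i), hP.2 N, Measure.pi_pi,
    Fin.prod_univ_eq_prod_range (fun i => π (u i)) N, ← Finset.prod_subset hN]
  · exact Finset.prod_congr rfl fun i hi => by simp [hu, hi]
  · intro i _ hi
    simp [hu, hi]

lemma constWealth_eq_exp_sum {A E : Type*} {φ : A → E → ℝ≥0} {a : A} {x : ℕ → E}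
    (hx : ∀ i, 0 < φ a (x i)) (n : ℕ) :
    (constWealth φ a n x : ℝ) = Real.exp (∑ i ∈ Finset.range n, Real.log (φ a (x i))) := by
  induction n with
  | zero => simp [constWealth]
  | succ n ih =>
    rw [constWealth, Finset.sum_range_succ, Real.exp_add,
      Real.exp_log (NNReal.coe_pos.2 (hx n)), ← ih, NNReal.coe_mul]

lemma measurable_constWealth {A : Type*} {φ : A → 𝒳 → ℝ≥0} {a : A}
    (hφ : Measurable (φ a)) (n : ℕ) :
    Measurable (constWealth φ a n) := by
  induction n with
  | zero => exact measurable_const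
  | succ n ih => exact ih.mul (hφ.comp (measurable_pi_apply n))

/-- Rejection from every initial wealth means that the log-wealth exceeds every level. -/
lemma forall_measure_reject_eq_one_iff {A : Type*} {φ : A → 𝒳 → ℝ≥0} {a : A}
    (hφ : Measurable (φ a))
    {α : ℝ≥0} (hα : 0 < α) {P : Measure (ℕ → 𝒳)} [IsProbabilityMeasure P]
    (hpos : ∀ᵐ x ∂P, ∀ i, 0 < φ a (x i)) :
    (∀ w : ℝ≥0, 0 < w → w < α⁻¹ →
        P {x | ∃ t : ℕ, 1 ≤ t ∧ α⁻¹ ≤ w * constWealth φ a t x} = 1) ↔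
      ∀ᵐ x ∂P, ∀ c : ℝ, ∃ n : ℕ, c ≤ ∑ i ∈ Finset.range n, Real.log (φ a (x i)) := by
  have hα' : (0 : ℝ) < (α : ℝ)⁻¹ := inv_pos.2 hα
  have hmeas (w : ℝ≥0) :
      MeasurableSet {x | ∃ t : ℕ, 1 ≤ t ∧ α⁻¹ ≤ w * constWealth φ a t x} := by
    simp only [ofPred_exists, ofPred_and]
    exact MeasurableSet.iUnion fun t => (MeasurableSet.const _).inter
      (measurableSet_le measurable_const ((measurable_constWealth hφ t).const_mul w))
  have hone (w : ℝ≥0) : P {x | ∃ t : ℕ, 1 ≤ t ∧ α⁻¹ ≤ w * constWealth φ a t x} = 1 ↔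
      ∀ᵐ x ∂P, ∃ t : ℕ, 1 ≤ t ∧ α⁻¹ ≤ w * constWealth φ a t x :=
    (mem_ae_iff_prob_eq_one (hmeas w)).symm
  simp only [hone]
  constructor
  · intro h
    have hlevel (m : ℕ) : ∀ᵐ x ∂P, ∃ t : ℕ, 1 ≤ t ∧
        α⁻¹ ≤ (α⁻¹ * (Real.exp (-(m + 1 : ℝ))).toNNReal) * constWealth φ a t x := by
      refine h _ (mul_pos (inv_pos.2 hα) (Real.toNNReal_pos.2 (Real.exp_pos _))) ?_
      refine mul_lt_of_lt_one_right (inv_pos.2 hα) (Real.toNNReal_lt_one.2 ?_)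
      exact Real.exp_lt_one_iff.2 (by linarith [m.cast_nonneg (α := ℝ)])
    filter_upwards [hpos, ae_all_iff.2 hlevel] with x hx hxl c
    obtain ⟨m, hm⟩ := exists_nat_ge c
    obtain ⟨t, -, ht⟩ := hxl m
    have ht' := NNReal.coe_le_coe.2 ht
    rw [NNReal.coe_mul, NNReal.coe_mul, Real.coe_toNNReal _ (Real.exp_pos _).le,
      constWealth_eq_exp_sum hx, mul_assoc, ← Real.exp_add, NNReal.coe_inv,
      le_mul_iff_one_le_right hα', Real.one_le_exp_iff] at ht'
    exact ⟨t, by linarith⟩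
  · intro h w hw hwα
    filter_upwards [hpos, h] with x hx hxc
    have hw' : (0 : ℝ) < w := hw
    have hratio : 1 < (α : ℝ)⁻¹ / w := (one_lt_div hw').2 (by exact_mod_cast hwα)
    obtain ⟨t, ht⟩ := hxc (Real.log ((α : ℝ)⁻¹ / w))
    refine ⟨t, Nat.one_le_iff_ne_zero.2 ?_, ?_⟩
    · rintro rfl
      have := Real.log_pos hratio
      simp only [Finset.range_zero, Finset.sum_empty] at ht
      linarith
    · rw [← NNReal.coe_le_coe, NNReal.coe_mul, constWealth_eq_exp_sum hx, NNReal.coe_inv,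
        mul_comm, ← div_le_iff₀ hw']
      exact (Real.log_le_iff_le_exp (by linarith)).1 ht

theorem power_one_iff_nonneg_drift
    (𝒳 𝒜 : Type*) [MeasurableSpace 𝒳] [StandardBorelSpace 𝒳]
    [MeasurableSpace 𝒜] [StandardBorelSpace 𝒜]
    (φ : 𝒜 → 𝒳 → ℝ≥0) (hφ : Measurable (fun p : 𝒜 × 𝒳 => φ p.1 p.2))
    (π₁ : Measure 𝒳) [IsProbabilityMeasure π₁]
    (α : ℝ≥0) (hα : 0 < α) (hα1 : α < 1)
    (a : 𝒜) (hpos : ∀ᵐ x ∂π₁, 0 < φ a x)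
    -- `γ(a) = 𝔼_{π₁}[log φ(a,·)]` is well-defined in `[-∞,∞]`: the positive part or the
    -- negative part of `log φ(a,·)` is integrable.
    (hwd : (∫⁻ x, ENNReal.ofReal (Real.log (φ a x)) ∂π₁) ≠ ⊤ ∨
           (∫⁻ x, ENNReal.ofReal (-Real.log (φ a x)) ∂π₁) ≠ ⊤)
    (P : Measure (ℕ → 𝒳)) (hP : IsIIDProduct π₁ P) :
    (∀ w : ℝ≥0, 0 < w → w < α⁻¹ →
        P {x | ∃ t : ℕ, 1 ≤ t ∧ α⁻¹ ≤ w * constWealth φ a t x} = 1)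
      ↔ ((∫⁻ x, ENNReal.ofReal (-Real.log (φ a x)) ∂π₁)
            < (∫⁻ x, ENNReal.ofReal (Real.log (φ a x)) ∂π₁)
        ∨ ((∫⁻ x, ENNReal.ofReal (Real.log (φ a x)) ∂π₁)
              = (∫⁻ x, ENNReal.ofReal (-Real.log (φ a x)) ∂π₁)
            ∧ 0 < π₁ {x | 0 < Real.log (φ a x)})) := by
  have : IsProbabilityMeasure P := hP.1
  have hφa : Measurable (φ a) := hφ.comp (measurable_const.prodMk measurable_id)
  have hPpos : ∀ᵐ x ∂P, ∀ i, 0 < φ a (x i) := by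
    rw [hP.eq_infinitePi]
    exact ae_all_iff.2 fun i =>
      (measurePreserving_eval_infinitePi (fun _ : ℕ => π₁) i).quasiMeasurePreserving.ae hpos
  rw [forall_measure_reject_eq_one_iff hφa hα hPpos, hP.eq_infinitePi]
  exact ae_unbounded_sum_iff (f := fun y => Real.log (φ a y))
    (Real.measurable_log.comp hφa.coe_nnreal_real) hwd

end
end
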